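/- arXiv:2407.08873 — 3 statements merged into one kernel-verified Lean document; each statement's English description precedes it below -/
import Mathlib

section
/- Let s and t be integers satisfying 1 ≤ s ≤ 3 ≤ t or t ≥ (s−1)! + 1. There exist a constant c > 0 and a positive integer N such that for every n ≥ N there is a 2-edge coloring E(K_{n,n}) = R ⊔ B with at least c·n^{2−1/s} edges in each color class which contains no copy of K_{s,t} all of whose edges are blue; consequently, for every T ≥ t this coloring contains no colored copy of K_{T,s+T} in which one color forms a K_{T,T} (with the other color forming a K_{T,s}), and no colored copy of K_{s,2T} in which one color forms a K_{s,T}. -/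
/-- The number of red edges in a 2-edge coloring of `K_{n,n}`.  The coloring is encoded
as `c : Fin n → Fin n → Bool`, where `c v w = true` means that the edge between vertex `v`
of the first part and vertex `w` of the second part is red, and `c v w = false` means it
is blue. -/
def redTotal {n : ℕ} (c : Fin n → Fin n → Bool) : ℕ :=
  (Finset.univ.filter fun p : Fin n × Fin n => c p.1 p.2 = true).card

/-- The number of blue edges in a 2-edge coloring of `K_{n,n}`. -/
def blueTotal {n : ℕ} (c : Fin n → Fin n → Bool) : ℕ :=
  (Finset.univ.filter fun p : Fin n × Fin n => c p.1 p.2 = false).card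

/-- `hasPattern c a b₁ b₂` says: the 2-edge coloring `c` of `K_{n,n}` contains a set `X` of
`a` vertices in one part and disjoint sets `Y₁` (of `b₁` vertices) and `Y₂` (of `b₂`
vertices) in the other part, together with a color `col`, such that every edge between `X`
and `Y₁` has color `col` and every edge between `X` and `Y₂` has the other color.
This is a colored copy of `K_{a, b₁ + b₂}` in which one color forms a `K_{a,b₁}`. -/
def hasPattern {n : ℕ} (c : Fin n → Fin n → Bool) (a b₁ b₂ : ℕ) : Prop :=
  ∃ (X Y₁ Y₂ : Finset (Fin n)) (col : Bool),
    X.card = a ∧ Y₁.card = b₁ ∧ Y₂.card = b₂ ∧ Disjoint Y₁ Y₂ ∧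
      (((∀ x ∈ X, ∀ y ∈ Y₁, c x y = col) ∧ (∀ x ∈ X, ∀ y ∈ Y₂, c x y = !col)) ∨
       ((∀ x ∈ X, ∀ y ∈ Y₁, c y x = col) ∧ (∀ x ∈ X, ∀ y ∈ Y₂, c y x = !col)))

/-- Nakayama's lemma for generation by a submodule. -/
theorem Submodule.exists_sub_one_mem_and_smul_mem {R N : Type*} [CommRing R] [AddCommGroup N]
    [Module R N] [Module.Finite R N] (I : Ideal R) (M : Submodule R N)
    (h : ∀ g : N, g ∈ M ⊔ I • (⊤ : Submodule R N)) : ∃ r : R, r - 1 ∈ I ∧ ∀ g : N, r • g ∈ M := by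
  have hq : (⊤ : Submodule R (N ⧸ M)) ≤ I • ⊤ := by
    rintro x -
    obtain ⟨g, rfl⟩ := M.mkQ_surjective x
    obtain ⟨m, hm, n, hn, rfl⟩ := Submodule.mem_sup.1 (h g)
    have h0 : M.mkQ m = 0 := (Submodule.Quotient.mk_eq_zero M).2 hm
    rw [map_add, h0, zero_add]
    have := Submodule.mem_map_of_mem (f := M.mkQ) hn
    rw [Submodule.map_smul''] at this
    exact Submodule.smul_mono le_rfl le_top this
  obtain ⟨r, hr, h⟩ := Submodule.exists_sub_one_mem_and_smul_eq_zero_of_fg_of_le_smul I ⊤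
    Module.Finite.fg_top hq
  exact ⟨r, hr, fun g => (Submodule.Quotient.mk_eq_zero M).1 (h (M.mkQ g) trivial)⟩

open MvPolynomial in
theorem MvPolynomial.exists_eval_eq {K σ ι : Type*} [Field K] [Fintype ι] {P : ι → σ → K}
    (hP : Function.Injective P) (v : ι → K) :
    ∃ g : MvPolynomial σ K, ∀ k, eval (P k) g = v k := by
  classical
  have sep : ∀ k l, ∃ h : MvPolynomial σ K,
      l ≠ k → eval (P k) h = 1 ∧ eval (P l) h = 0 := by
    intro k l
    by_cases hl : l = k
    · exact ⟨0, fun h => absurd hl h⟩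
    obtain ⟨i, hi⟩ := Function.ne_iff.1 (fun h => hl (hP h))
    refine ⟨C (P k i - P l i)⁻¹ * (X i - C (P l i)), fun _ => ⟨?_, by simp⟩⟩
    simpa using inv_mul_cancel₀ (sub_ne_zero.2 hi.symm)
  choose h hh using sep
  refine ⟨∑ k, C (v k) * ∏ l ∈ Finset.univ.erase k, h k l, fun m => ?_⟩
  rw [map_sum, Finset.sum_eq_single m]
  · rw [map_mul, eval_C, map_prod, Finset.prod_eq_one, mul_one]
    exact fun l hl => (hh m l (Finset.ne_of_mem_erase hl)).1
  · intro k _ hk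
    rw [map_mul, map_prod, Finset.prod_eq_zero (i := m) (by simp [hk.symm]) (hh k m hk.symm).2,
      mul_zero]
  · simp

/-- The polynomial `∏ i, (X i - a i j)`, an abstraction of a norm form. -/
noncomputable def splitForm {K ι : Type*} [Field K] [Fintype ι] (a : ι → ι → K) (j : ι) :
    MvPolynomial ι K :=
  ∏ i, (MvPolynomial.X i - MvPolynomial.C (a i j))

section SplitForm

open MvPolynomial

variable {K ι : Type*} [Field K] [Fintype ι] {a : ι → ι → K}

theorem isIntegral_X_of_splitForm (ha : ∀ i, Function.Injective (a i)) (i : ι) :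
    IsIntegral (Algebra.adjoin K (Set.range (splitForm a))) (X i : MvPolynomial ι K) := by
  classical
  set B := Algebra.adjoin K (Set.range (splitForm a))
  let L := FractionRing (MvPolynomial ι K)
  let φ : MvPolynomial ι K →+* L := algebraMap _ L
  have hφ : Function.Injective φ := IsFractionRing.injective _ _
  have key : φ (X i) ∈ integralClosure B L := by
    by_contra hx
    obtain ⟨V, hV, hxV⟩ := Subring.exists_le_valuationSubring_of_isIntegrallyClosedIn
      (R := (integralClosure B L).toSubring) hx
    have hB : ∀ b ∈ B, φ b ∈ V := fun b hb =>
      hV ((integralClosure B L).algebraMap_mem ⟨b, hb⟩)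
    have hC : ∀ c : K, φ (C c) ∈ V := fun c => hB _ (B.algebraMap_mem c)
    have hVle : ∀ y : L, y ∈ V ↔ V.valuation y ≤ 1 := fun y => (V.valuation_le_one_iff y).symm
    have hCne : ∀ c : K, c ≠ 0 → V.valuation (φ (C c)) = 1 := by
      intro c hc
      refine le_antisymm ((hVle _).1 (hC c)) ?_
      have h1 : V.valuation (φ (C c)) * V.valuation (φ (C c⁻¹)) = 1 := by
        rw [← map_mul, ← map_mul, ← C_mul, mul_inv_cancel₀ hc, C_1, map_one, map_one]
      calc (1 : V.ValueGroup) = V.valuation (φ (C c)) * V.valuation (φ (C c⁻¹)) := h1.symm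
        _ ≤ V.valuation (φ (C c)) * 1 := by gcongr; exact (hVle _).1 (hC _)
        _ = _ := mul_one _
    have huniq : ∀ k j j', V.valuation (φ (X k - C (a k j))) < 1 →
        V.valuation (φ (X k - C (a k j'))) < 1 → j = j' := by
      intro k j j' h h'
      by_contra hne
      have := hCne (a k j - a k j') (sub_ne_zero.2 fun h => hne (ha k h))
      have h2 : φ (C (a k j - a k j')) = φ (X k - C (a k j')) - φ (X k - C (a k j)) := by
        rw [← map_sub]; congr 1; rw [C_sub]; ring
      rw [h2] at this
      exact absurd this (ne_of_lt (V.valuation.map_sub_lt h' h))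
    have hbig : ∀ j, 1 < V.valuation (φ (X i - C (a i j))) := by
      intro j
      by_contra hle
      have := V.add_mem _ _ ((hVle _).2 (not_lt.1 hle)) (hC (a i j))
      rw [← map_add, sub_add_cancel] at this
      exact hxV this
    have hj : ∃ j, ∀ k, 1 ≤ V.valuation (φ (X k - C (a k j))) := by
      by_contra! hcon
      choose k hk using hcon
      have hinj : Function.Injective k := by
        intro j j' h
        exact huniq (k j) j j' (hk j) (by rw [h]; exact hk j')
      obtain ⟨j, hj⟩ := (Finite.injective_iff_surjective.1 hinj) i
      have := hk j
      rw [hj] at this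
      exact absurd this (not_lt.2 (hbig j).le)
    obtain ⟨j, hj⟩ := hj
    have hf : V.valuation (φ (splitForm a j)) ≤ 1 :=
      (hVle _).1 (hB _ (Algebra.subset_adjoin ⟨j, rfl⟩))
    rw [splitForm, map_prod, map_prod, ← Finset.mul_prod_erase _ _ (Finset.mem_univ i)] at hf
    have h1 : 1 ≤ ∏ k ∈ Finset.univ.erase i, V.valuation (φ (X k - C (a k j))) :=
      Finset.one_le_prod' fun k _ => hj k
    exact absurd ((hbig j).trans_le (le_mul_of_one_le_right' h1)) (not_lt.2 hf)
  exact (isIntegral_algebraMap_iff hφ).1 key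

theorem mem_span_splitForm (ha : ∀ i, Function.Injective (a i)) {g : MvPolynomial ι K}
    (hg : ∀ π : Equiv.Perm ι, eval (fun i => a i (π i)) g = 0) :
    g ∈ Ideal.span (Set.range (splitForm a)) := by
  classical
  set I := Ideal.span (Set.range (splitForm a))
  have hI : ∀ j, splitForm a j ∈ I := fun j => Ideal.subset_span ⟨j, rfl⟩
  let J : Ideal (MvPolynomial ι K) := Submodule.comap (LinearMap.mulRight _ g) I
  have hJ : ∀ u, u ∈ J ↔ u * g ∈ I := fun u => Iff.rfl
  have hIJ : I ≤ J := fun u hu => (hJ u).2 (I.mul_mem_right _ hu)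
  suffices J = ⊤ by
    have h1 : (1 : MvPolynomial ι K) ∈ J := this ▸ Submodule.mem_top
    simpa [hJ] using h1
  by_contra hne
  obtain ⟨𝔫, hmax, hle⟩ := Ideal.exists_le_maximal J hne
  have hprime := hmax.isPrime
  have hex : ∀ j, ∃ k, X k - C (a k j) ∈ 𝔫 := by
    intro j
    have := hle (hIJ (hI j))
    rw [splitForm, hprime.prod_mem_iff] at this
    obtain ⟨k, _, hk⟩ := this
    exact ⟨k, hk⟩
  have huniq : ∀ k j j', X k - C (a k j) ∈ 𝔫 → X k - C (a k j') ∈ 𝔫 → j = j' := by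
    intro k j j' h h'
    by_contra hne
    have h2 := 𝔫.sub_mem h' h
    rw [sub_sub_sub_cancel_left, ← C_sub] at h2
    exact hprime.ne_top (𝔫.eq_top_of_isUnit_mem h2
      ((sub_ne_zero.2 fun h => hne (ha k h)).isUnit.map C))
  choose k hk using hex
  have hinj : Function.Injective k := fun j j' h =>
    huniq (k j) j j' (hk j) (by rw [h]; exact hk j')
  let τ : Equiv.Perm ι := Equiv.ofBijective k (Finite.injective_iff_bijective.1 hinj)
  let u : MvPolynomial ι K := ∏ j, ∏ i ∈ Finset.univ.erase (k j), (X i - C (a i j))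
  have hu : u ∉ 𝔫 := by
    intro h
    rw [hprime.prod_mem_iff] at h
    obtain ⟨j, _, h⟩ := h
    rw [hprime.prod_mem_iff] at h
    obtain ⟨i, hi, h⟩ := h
    obtain ⟨j', rfl⟩ := τ.surjective i
    have : j = j' := huniq (k j') j j' h (hk j')
    exact (Finset.ne_of_mem_erase hi) (by rw [this]; rfl)
  have hX : ∀ i, u * (X i - C (a i (τ.symm i))) ∈ I := by
    intro i
    obtain ⟨j, rfl⟩ := τ.surjective i
    rw [τ.symm_apply_apply]
    have : u * (X (k j) - C (a (k j) j)) =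
        (∏ l ∈ Finset.univ.erase j, ∏ i ∈ Finset.univ.erase (k l), (X i - C (a i l))) *
          splitForm a j := by
      rw [splitForm, ← Finset.mul_prod_erase _ _ (Finset.mem_univ (k j))]
      simp only [u]
      rw [← Finset.mul_prod_erase _ _ (Finset.mem_univ j)]
      ring
    exact this ▸ I.mul_mem_left _ (hI j)
  have hall : ∀ h : MvPolynomial ι K,
      u * (h - C (eval (fun i => a i (τ.symm i)) h)) ∈ I := by
    intro h
    induction h using MvPolynomial.induction_on with
    | C c => simp
    | add p q hp hq =>
      convert I.add_mem hp hq using 1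
      rw [map_add, C_add]; ring
    | mul_X p i hp =>
      convert I.add_mem (I.mul_mem_right (X i) hp)
        (I.mul_mem_left (C (eval (fun i => a i (τ.symm i)) p)) (hX i)) using 1
      rw [map_mul, eval_X, C_mul]; ring
  have := hall g
  rw [hg τ.symm, C_0, sub_zero] at this
  exact hu (hle ((hJ u).2 this))

/-- The lemma of Kollár, Rónyai and Szabó bounding the number of solutions of a system
`∏ i, (x i - a i j) = b j`. -/
theorem card_le_factorial_of_splitForm [Infinite K] (ha : ∀ i, Function.Injective (a i))
    (b : ι → K) (S : Finset (ι → K)) (hS : ∀ x ∈ S, ∀ j, ∏ i, (x i - a i j) = b j) :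
    S.card ≤ (Fintype.card ι).factorial := by
  classical
  set B := Algebra.adjoin K (Set.range (splitForm a))
  have hint : Algebra.IsIntegral B (MvPolynomial ι K) := by
    refine ⟨fun p => ?_⟩
    induction p using MvPolynomial.induction_on with
    | C c => exact isIntegral_algebraMap (x := (algebraMap K B c))
    | add p q hp hq => exact hp.add hq
    | mul_X p i hp => exact hp.mul (isIntegral_X_of_splitForm ha i)
  have hfin : Module.Finite B (MvPolynomial ι K) := by
    have : Algebra.FiniteType B (MvPolynomial ι K) :=
      Algebra.FiniteType.of_restrictScalars_finiteType K B _
    exact Algebra.IsIntegral.finite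
  have hindep : AlgebraicIndependent K (splitForm a) := by
    have : Algebra.IsAlgebraic B (MvPolynomial ι K) := inferInstance
    refine (Algebra.IsAlgebraic.isTranscendenceBasis_of_lift_le_trdeg_of_finite K
      (splitForm a) ?_).1
    rw [MvPolynomial.trdeg_of_isDomain]
    simp
  have hclosed : IsIntegrallyClosed B :=
    IsIntegrallyClosed.of_equiv hindep.aevalEquiv.toRingEquiv
  -- a family of elements generating the polynomial ring at the origin
  let P : Equiv.Perm ι → ι → K := fun π i => a i (π i)
  have hP : Function.Injective P := fun π σ h => Equiv.ext fun i => ha i (congrFun h i)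
  choose e he using fun π : Equiv.Perm ι =>
    MvPolynomial.exists_eval_eq hP (fun σ => if σ = π then 1 else 0)
  let M : Submodule B (MvPolynomial ι K) := Submodule.span B (Set.range e)
  let 𝔪 : Ideal B := Ideal.span (Set.range fun j =>
    (⟨splitForm a j, Algebra.subset_adjoin ⟨j, rfl⟩⟩ : B))
  have h𝔪 : ∀ r ∈ 𝔪, eval (P 1) (r : MvPolynomial ι K) = 0 := by
    intro r hr
    have : 𝔪 ≤ RingHom.ker ((eval (P 1)).comp (algebraMap B (MvPolynomial ι K))) := by
      rw [Ideal.span_le]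
      rintro _ ⟨j, rfl⟩
      change eval (P 1) (splitForm a j) = 0
      rw [splitForm, map_prod]
      exact Finset.prod_eq_zero (Finset.mem_univ j) (by simp [P])
    exact this hr
  have hdecomp : ∀ g : MvPolynomial ι K, g ∈ M ⊔ 𝔪 • (⊤ : Submodule B (MvPolynomial ι K)) := by
    intro g
    have h1 : g - ∑ π, C (eval (P π) g) * e π ∈ Ideal.span (Set.range (splitForm a)) := by
      refine mem_span_splitForm ha fun σ => ?_
      change eval (P σ) _ = 0
      simp [he]
    have h2 : ∑ π, C (eval (P π) g) * e π ∈ M :=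
      M.sum_mem fun π _ => M.smul_mem (algebraMap K B (eval (P π) g))
        (Submodule.subset_span ⟨π, rfl⟩)
    have h3 : ∀ f ∈ Ideal.span (Set.range (splitForm a)),
        f ∈ 𝔪 • (⊤ : Submodule B (MvPolynomial ι K)) := by
      intro f hf
      induction hf using Submodule.span_induction with
      | mem x hx =>
        obtain ⟨j, rfl⟩ := hx
        have := Submodule.smul_mem_smul (N := (⊤ : Submodule B (MvPolynomial ι K)))
          (Ideal.subset_span ⟨j, rfl⟩ :
            (⟨splitForm a j, Algebra.subset_adjoin ⟨j, rfl⟩⟩ : B) ∈ 𝔪)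
          (Submodule.mem_top (x := (1 : MvPolynomial ι K)))
        rwa [Subalgebra.smul_def, smul_eq_mul, mul_one] at this
      | zero => exact Submodule.zero_mem _
      | add x y _ _ hx hy => exact Submodule.add_mem _ hx hy
      | smul c x _ hx =>
        refine Submodule.smul_induction_on hx (fun r hr n _ => ?_) fun x y hx hy => ?_
        · rw [smul_eq_mul, mul_smul_comm]
          exact Submodule.smul_mem_smul hr Submodule.mem_top
        · rw [smul_add]; exact Submodule.add_mem _ hx hy
    rw [← add_sub_cancel (∑ π, C (eval (P π) g) * e π) g]
    exact Submodule.add_mem_sup h2 (h3 _ h1)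
  obtain ⟨r, hr, hrM⟩ : ∃ r : B, r ≠ 0 ∧ ∀ g : MvPolynomial ι K, r • g ∈ M := by
    obtain ⟨r, hr, h⟩ := Submodule.exists_sub_one_mem_and_smul_mem 𝔪 M hdecomp
    refine ⟨r, ?_, h⟩
    rintro rfl
    have := h𝔪 _ hr
    simp at this
  -- an element separating the given solutions
  obtain ⟨v⟩ : Nonempty (S ↪ K) := ⟨(Fintype.equivFin S).toEmbedding.trans
    (Fin.valEmbedding.trans (Infinite.natEmbedding K))⟩
  obtain ⟨g, hg⟩ := MvPolynomial.exists_eval_eq (P := fun x : S => (x : ι → K))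
    Subtype.val_injective v
  set n := (Fintype.card ι).factorial
  have hq : ∃ q : Polynomial B, q ≠ 0 ∧ q.natDegree ≤ n ∧ Polynomial.aeval g q = 0 := by
    have hdep : ¬ LinearIndependent B (fun k : Fin (n + 1) => r • g ^ (k : ℕ)) := by
      intro hli
      have h1 := linearIndependent_le_span' _ hli (Set.range e) (by
        rintro _ ⟨k, rfl⟩; exact hrM _)
      rw [Cardinal.mk_fin] at h1
      have h2 : n + 1 ≤ Fintype.card (Set.range e) := by exact_mod_cast h1
      have h3 := Fintype.card_range_le e
      rw [Fintype.card_perm] at h3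
      omega
    rw [Fintype.not_linearIndependent_iff] at hdep
    obtain ⟨c, hc, k, hk⟩ := hdep
    refine ⟨∑ k : Fin (n + 1), Polynomial.monomial (k : ℕ) (c k), ?_, ?_, ?_⟩
    · intro h
      apply hk
      have := congrArg (fun q => Polynomial.coeff q (k : ℕ)) h
      simpa [Polynomial.finsetSum_coeff, Polynomial.coeff_monomial, Fin.val_inj] using this
    · refine Polynomial.natDegree_sum_le_of_forall_le _ _ fun k _ => ?_
      exact (Polynomial.natDegree_monomial_le _).trans (Nat.lt_succ_iff.1 k.2)
    · have h1 : r • (∑ k : Fin (n + 1), c k • g ^ (k : ℕ)) = 0 := by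
        rw [Finset.smul_sum, ← hc]
        exact Finset.sum_congr rfl fun k _ => smul_comm _ _ _
      have h2 := (smul_eq_zero.1 h1).resolve_left hr
      simpa [Polynomial.aeval_monomial, Algebra.smul_def] using h2
  obtain ⟨q, hq0, hqdeg, hqg⟩ := hq
  have hgint : IsIntegral B g := hint.isIntegral g
  have hdeg : (minpoly B g).natDegree ≤ n :=
    (Polynomial.natDegree_le_of_dvd (minpoly.isIntegrallyClosed_dvd hgint hqg) hq0).trans hqdeg
  -- reduction of the minimal polynomial at the point `b`
  rcases S.eq_empty_or_nonempty with rfl | ⟨x₀, hx₀⟩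
  · simp
  let θ : (ι → K) → B →+* K := fun x => (eval x).comp (algebraMap B (MvPolynomial ι K))
  have hθ : ∀ x ∈ S, θ x = θ x₀ := by
    intro x hx
    ext ⟨f, hf⟩
    change eval x f = eval x₀ f
    induction hf using Algebra.adjoin_induction with
    | mem f hf =>
      obtain ⟨j, rfl⟩ := hf
      simp [splitForm, hS x hx j, hS x₀ hx₀ j]
    | algebraMap c => simp
    | add f g _ _ hf hg => rw [map_add, map_add, hf, hg]
    | mul f g _ _ hf hg => rw [map_mul, map_mul, hf, hg]
  let p := (minpoly B g).map (θ x₀)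
  have hpm : p.Monic := (minpoly.monic hgint).map _
  have hroot : ∀ x : S, v x ∈ p.roots.toFinset := by
    intro x
    rw [Multiset.mem_toFinset, Polynomial.mem_roots hpm.ne_zero, Polynomial.IsRoot.def,
      Polynomial.eval_map, ← hθ x x.2, ← hg x]
    change Polynomial.eval₂ ((eval (x : ι → K)).comp _) _ _ = 0
    rw [← Polynomial.hom_eval₂]
    change eval _ (Polynomial.aeval g (minpoly B g)) = 0
    rw [minpoly.aeval, map_zero]
  calc S.card = (Finset.univ.map v).card := by simp
    _ ≤ p.roots.toFinset.card := Finset.card_le_card fun y hy => by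
        obtain ⟨x, _, rfl⟩ := Finset.mem_map.1 hy
        exact hroot x
    _ ≤ p.natDegree := (Multiset.toFinset_card_le _).trans (Polynomial.card_roots' p)
    _ ≤ n := Polynomial.natDegree_map_le.trans hdeg

end SplitForm

section NormGraph

variable (p : ℕ) [Fact p.Prime] (m : ℕ)

/-- A system of norm equations `N (z + D j) = b j` has at most `m!` solutions. -/
theorem card_le_factorial_of_norm (hm : m ≠ 0) {D : Fin m → GaloisField p m}
    (hD : Function.Injective D) (b : Fin m → ZMod p) (Z : Finset (GaloisField p m))
    (hZ : ∀ z ∈ Z, ∀ j, Algebra.norm (ZMod p) (z + D j) = b j) : Z.card ≤ m.factorial := by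
  classical
  let E := GaloisField p m
  let K := AlgebraicClosure E
  have : Infinite K := inferInstance
  let φ : E →+* K := algebraMap E K
  have hφ : Function.Injective φ := φ.injective
  have hnorm : ∀ x : E, algebraMap (ZMod p) E (Algebra.norm (ZMod p) x) =
      ∏ i : Fin m, x ^ (p ^ (i : ℕ)) := by
    intro x
    rw [FiniteField.algebraMap_norm_eq_prod_pow, GaloisField.finrank p hm, Nat.card_zmod,
      Finset.prod_range]
  let ψ : E → Fin m → K := fun z i => φ (z ^ (p ^ (i : ℕ)))
  have hψ : Function.Injective ψ := by
    intro z z' h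
    have := hφ (congrFun h ⟨0, Nat.pos_of_ne_zero hm⟩)
    simpa using this
  have key := card_le_factorial_of_splitForm (K := K)
    (a := fun i j => φ (-(D j ^ (p ^ (i : ℕ))))) (fun i j j' h => by
      have h1 : D j ^ (p ^ (i : ℕ)) = D j' ^ (p ^ (i : ℕ)) := neg_injective (hφ h)
      exact hD (iterateFrobenius_inj E p i h1))
    (fun j => φ (algebraMap (ZMod p) E (b j))) (Z.image ψ) (by
      intro x hx j
      obtain ⟨z, hz, rfl⟩ := Finset.mem_image.1 hx
      rw [← hZ z hz j, hnorm, map_prod]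
      refine Finset.prod_congr rfl fun i _ => ?_
      rw [← map_sub, sub_neg_eq_add, add_pow_char_pow])
  rwa [Finset.card_image_of_injective _ hψ, Fintype.card_fin] at key

/-- Adjacency in the projective norm graph. -/
def normAdj (u v : GaloisField p m × (ZMod p)ˣ) : Prop :=
  Algebra.norm (ZMod p) (u.1 + v.1) = u.2 * v.2

variable {p m}

theorem normAdj.symm {u v : GaloisField p m × (ZMod p)ˣ} (h : normAdj p m u v) :
    normAdj p m v u := by
  rw [normAdj, add_comm, mul_comm]; exact h

theorem normAdj.add_ne_zero {u v : GaloisField p m × (ZMod p)ˣ} (h : normAdj p m u v) :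
    u.1 + v.1 ≠ 0 := by
  intro h0
  rw [normAdj, h0, Algebra.norm_zero] at h
  exact (u.2 * v.2).ne_zero (by rw [Units.val_mul]; exact h.symm)

theorem normAdj.eq_of_fst_eq {u v v' : GaloisField p m × (ZMod p)ˣ} (h : normAdj p m u v)
    (h' : normAdj p m u v') (hv : v.1 = v'.1) : v = v' := by
  refine Prod.ext hv (Units.ext (mul_left_cancel₀ u.2.ne_zero ?_))
  rw [← show _ = _ from h, ← show _ = _ from h', hv]

theorem card_le_factorial_of_normAdj (hm : m ≠ 0) (X Y : Finset (GaloisField p m × (ZMod p)ˣ))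
    (hX : X.card = m + 1) (h : ∀ x ∈ X, ∀ y ∈ Y, normAdj p m x y) : Y.card ≤ m.factorial := by
  classical
  rcases Y.eq_empty_or_nonempty with rfl | ⟨y₀, hy₀⟩
  · simp
  obtain ⟨x₀, hx₀⟩ : X.Nonempty := Finset.card_pos.1 (by omega)
  have hcard : Fintype.card (X.erase x₀) = m := by
    rw [Fintype.card_coe, Finset.card_erase_of_mem hx₀, hX, Nat.add_sub_cancel]
  let e := (Fintype.equivFinOfCardEq hcard).symm
  let x : Fin m → GaloisField p m × (ZMod p)ˣ := fun j => e j
  have hxX : ∀ j, x j ∈ X := fun j => Finset.mem_of_mem_erase (e j).2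
  have hfst : ∀ u ∈ X, ∀ v ∈ X, u.1 = v.1 → u = v := fun u hu v hv huv =>
    (h u hu y₀ hy₀).symm.eq_of_fst_eq (h v hv y₀ hy₀).symm huv
  have hsub : ∀ j, (x j).1 - x₀.1 ≠ 0 := fun j h0 =>
    Finset.ne_of_mem_erase (e j).2 (hfst _ (hxX j) _ hx₀ (sub_eq_zero.1 h0))
  let D : Fin m → GaloisField p m := fun j => ((x j).1 - x₀.1)⁻¹
  have hD : Function.Injective D := by
    intro j j' hj
    have h1 : (x j).1 = (x j').1 := sub_left_injective (inv_injective hj)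
    exact e.injective (Subtype.ext (hfst _ (hxX j) _ (hxX j') h1))
  let ζ : GaloisField p m × (ZMod p)ˣ → GaloisField p m := fun y => (x₀.1 + y.1)⁻¹
  have hζ : Set.InjOn ζ Y := by
    intro y hy y' hy' hyy
    exact (h x₀ hx₀ y hy).eq_of_fst_eq (h x₀ hx₀ y' hy')
      (add_right_injective _ (inv_injective hyy))
  rw [← Finset.card_image_of_injOn hζ]
  refine card_le_factorial_of_norm p m hm hD
    (fun j => (x j).2 / (x₀.2 * Algebra.norm (ZMod p) ((x j).1 - x₀.1))) _ fun z hz j => ?_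
  obtain ⟨y, hy, rfl⟩ := Finset.mem_image.1 hz
  have hy0 := (h x₀ hx₀ y hy).add_ne_zero
  have h1 : (ζ y + D j) * ((x₀.1 + y.1) * ((x j).1 - x₀.1)) = (x j).1 + y.1 := by
    have := hsub j
    simp only [ζ, D]
    field_simp
    ring
  have hN : Algebra.norm (ZMod p) ((x j).1 - x₀.1) ≠ 0 := Algebra.norm_ne_zero_iff.2 (hsub j)
  have h2 := congrArg (Algebra.norm (ZMod p)) h1
  rw [map_mul, map_mul, show _ = _ from h _ (hxX j) y hy, show _ = _ from h x₀ hx₀ y hy] at h2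
  rw [eq_div_iff (mul_ne_zero x₀.2.ne_zero hN)]
  refine mul_right_cancel₀ y.2.ne_zero ?_
  rw [← h2]
  ring

theorem le_card_normAdj (hm : m ≠ 0) :
    p ^ (2 * m + 1) ≤ 4 * Nat.card {e : (GaloisField p m × (ZMod p)ˣ) ×
      (GaloisField p m × (ZMod p)ˣ) // normAdj p m e.1 e.2} := by
  classical
  let E := GaloisField p m
  have : Fintype E := Fintype.ofFinite E
  let F : E × Eˣ × (ZMod p)ˣ → {e : (E × (ZMod p)ˣ) × (E × (ZMod p)ˣ) // normAdj p m e.1 e.2} :=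
    fun w => ⟨((w.1, w.2.2), (w.2.1 - w.1,
      Units.map (Algebra.norm (ZMod p) : E →* ZMod p) w.2.1 / w.2.2)), by
        rw [normAdj, ← Units.val_mul, mul_div_cancel]
        simp⟩
  have hF : Function.Injective F := by
    rintro ⟨A, w, a⟩ ⟨A', w', a'⟩ h
    simp only [F, Subtype.mk.injEq, Prod.mk.injEq] at h
    obtain ⟨⟨rfl, rfl⟩, h2, -⟩ := h
    have : w = w' := Units.ext (sub_left_injective h2)
    rw [this]
  have hcard := Nat.card_le_card_of_injective F hF
  have hE : Nat.card E = p ^ m := GaloisField.card p m hm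
  rw [Nat.card_prod, Nat.card_prod, Nat.card_units, Nat.card_units, hE, Nat.card_zmod] at hcard
  have hp : p ≤ 2 * (p - 1) := by have := (Fact.out : p.Prime).two_le; omega
  have hq : p ^ m ≤ 2 * (p ^ m - 1) := by
    have : 2 ≤ p ^ m := (Fact.out : p.Prime).two_le.trans (Nat.le_self_pow hm p)
    omega
  calc p ^ (2 * m + 1) = p ^ m * (p ^ m * p) := by ring
    _ ≤ p ^ m * ((2 * (p ^ m - 1)) * (2 * (p - 1))) := by gcongr
    _ = 4 * (p ^ m * ((p ^ m - 1) * (p - 1))) := by ring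
    _ ≤ _ := by gcongr

variable (p m)

/-- Dense graphs on `p ^ m * (p - 1)` vertices without `K_{m+1,m!+1}`. -/
theorem exists_dense_adj : ∃ (V : Type) (_ : Fintype V) (adj : V → V → Prop),
    Fintype.card V = p ^ m * (p - 1) ∧ (∀ u v, adj u v → adj v u) ∧
    p ^ (2 * m + 1) ≤ 4 * Nat.card {e : V × V // adj e.1 e.2} ∧
    ∀ X Y : Finset V, X.card = m + 1 → (∀ x ∈ X, ∀ y ∈ Y, adj x y) →
      Y.card ≤ m.factorial := by
  classical
  rcases eq_or_ne m 0 with rfl | hm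
  · refine ⟨(ZMod p)ˣ, inferInstance, Eq, by
      rw [ZMod.card_units, pow_zero, one_mul], fun _ _ => Eq.symm, ?_, ?_⟩
    · have h := Nat.card_le_card_of_injective
        (fun u : (ZMod p)ˣ => (⟨(u, u), rfl⟩ : {e : (ZMod p)ˣ × (ZMod p)ˣ // e.1 = e.2}))
        fun u v h => congrArg (fun e => e.1.1) h
      rw [Nat.card_units, Nat.card_zmod] at h
      have := (Fact.out : p.Prime).two_le
      simp only [mul_zero, zero_add, pow_one]
      omega
    · intro X Y hX h
      obtain ⟨x, hx⟩ := Finset.card_pos.1 (hX.symm ▸ Nat.succ_pos 0 : 0 < X.card)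
      exact Finset.card_le_one.2 fun y hy y' hy' => (h x hx y hy).symm.trans (h x hx y' hy')
  · have : Fintype (GaloisField p m) := Fintype.ofFinite _
    refine ⟨GaloisField p m × (ZMod p)ˣ, inferInstance, normAdj p m, ?_, fun _ _ h => h.symm,
      le_card_normAdj hm, fun X Y => card_le_factorial_of_normAdj hm X Y⟩
    rw [Fintype.card_prod, ZMod.card_units, ← Nat.card_eq_fintype_card, GaloisField.card p m hm]

end NormGraph

section Coloring

/-- A coloring of `K_{n,n}` from a prime whose `(m + 1)`-st power is at most `n`. -/
theorem exists_coloring (p m n : ℕ) (hp : p.Prime) (hn : p ^ (m + 1) ≤ n) :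
    ∃ c : Fin n → Fin n → Bool, p ^ (2 * m + 1) ≤ 4 * redTotal c ∧
      p ^ (2 * m + 1) ≤ 4 * blueTotal c ∧ (∀ v w, c v w = c w v) ∧
      ∀ X Y : Finset (Fin n), X.card = m + 1 → (∀ x ∈ X, ∀ y ∈ Y, c x y = false) →
        Y.card ≤ m.factorial := by
  classical
  have := Fact.mk hp
  obtain ⟨V, _, adj, hV, hsymm, hedge, hfree⟩ := exists_dense_adj p m
  have hVn : Fintype.card V + p ^ m ≤ n := by
    refine le_trans (le_of_eq ?_) hn
    rw [hV, pow_succ, ← Nat.mul_succ, Nat.succ_eq_add_one, Nat.sub_add_cancel hp.one_le]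
  obtain ⟨f⟩ : Nonempty (V ↪ Fin n) := Function.Embedding.nonempty_of_card_le (by
    rw [Fintype.card_fin]; omega)
  let blue : Fin n → Fin n → Prop := fun v w => ∃ x y, f x = v ∧ f y = w ∧ adj x y
  have hblue : ∀ x y, blue (f x) (f y) ↔ adj x y := by
    refine fun x y => ⟨?_, fun h => ⟨x, y, rfl, rfl, h⟩⟩
    rintro ⟨x', y', hx, hy, h⟩
    rwa [← f.injective hx, ← f.injective hy]
  have hfalse : ∀ v w, (!decide (blue v w)) = false ↔ blue v w := by simp
  refine ⟨fun v w => !decide (blue v w), ?_, ?_, ?_, ?_⟩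
  · let U : Finset (Fin n) := (Finset.univ.map f)ᶜ
    have hU : p ^ m ≤ U.card := by
      rw [Finset.card_compl, Finset.card_map, Fintype.card_fin, Finset.card_univ]
      omega
    have hsub : U ×ˢ (Finset.univ : Finset (Fin n)) ⊆
        Finset.univ.filter fun q : Fin n × Fin n => (!decide (blue q.1 q.2)) = true := by
      rintro ⟨v, w⟩ h
      have hv : v ∉ Finset.univ.map f := Finset.mem_compl.1 (Finset.mem_product.1 h).1
      simp only [Finset.mem_filter, Finset.mem_univ, true_and, Bool.not_eq_true',
        decide_eq_false_iff_not]
      rintro ⟨x, y, hx, -, -⟩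
      exact hv (Finset.mem_map.2 ⟨x, Finset.mem_univ x, hx⟩)
    have hle := Finset.card_le_card hsub
    rw [Finset.card_product, Finset.card_univ, Fintype.card_fin] at hle
    calc p ^ (2 * m + 1) = p ^ m * p ^ (m + 1) := by ring
      _ ≤ U.card * n := by gcongr
      _ ≤ _ := hle
      _ ≤ _ := Nat.le_mul_of_pos_left _ (by norm_num)
  · refine hedge.trans (Nat.mul_le_mul_left 4 ?_)
    rw [Nat.card_eq_fintype_card, Fintype.card_subtype]
    refine (Finset.card_map (f.prodMap f)).symm.trans_le (Finset.card_le_card ?_)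
    intro q hq
    obtain ⟨e, he, rfl⟩ := Finset.mem_map.1 hq
    simp only [Finset.mem_filter, Finset.mem_univ, true_and] at he ⊢
    exact (hfalse _ _).2 ((hblue _ _).2 he)
  · have hs : ∀ v w, blue v w → blue w v := by
      rintro v w ⟨x, y, hx, hy, h⟩
      exact ⟨y, x, hy, hx, hsymm _ _ h⟩
    intro v w
    simp only [show blue v w ↔ blue w v from ⟨hs v w, hs w v⟩]
  · intro X Y hX h
    simp only [hfalse] at h
    rcases Y.eq_empty_or_nonempty with rfl | ⟨y₀, hy₀⟩
    · simp
    obtain ⟨x₀, hx₀⟩ : X.Nonempty := Finset.card_pos.1 (by omega)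
    have hmap : ∀ Z : Finset (Fin n), (∀ z ∈ Z, ∃ x, f x = z) → ∃ Z' : Finset V, Z'.map f = Z := by
      intro Z hZ
      refine ⟨Finset.univ.filter fun x => f x ∈ Z, Finset.ext fun z => ?_⟩
      simp only [Finset.mem_map, Finset.mem_filter, Finset.mem_univ, true_and]
      constructor
      · rintro ⟨x, hx, rfl⟩; exact hx
      · intro hz
        obtain ⟨x, rfl⟩ := hZ z hz
        exact ⟨x, hz, rfl⟩
    obtain ⟨X', rfl⟩ := hmap X fun x hx => by
      obtain ⟨u, _, hu, -, -⟩ := h x hx y₀ hy₀; exact ⟨u, hu⟩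
    obtain ⟨Y', rfl⟩ := hmap Y fun y hy => by
      obtain ⟨_, v, -, hv, -⟩ := h x₀ hx₀ y hy; exact ⟨v, hv⟩
    rw [Finset.card_map] at hX ⊢
    exact hfree X' Y' hX fun x hx y hy =>
      (hblue x y).1 (h _ (Finset.mem_map_of_mem f hx) _ (Finset.mem_map_of_mem f hy))

theorem exists_prime_pow_le (s n : ℕ) (hs : s ≠ 0) (hn : 2 ^ s ≤ n) :
    ∃ p : ℕ, p.Prime ∧ p ^ s ≤ n ∧ n ≤ (2 * p) ^ s := by
  let k := Nat.findGreatest (fun k => (2 * k) ^ s ≤ n) n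
  have h1n : 1 ≤ n := Nat.one_le_two_pow.trans hn
  have hk : (2 * k) ^ s ≤ n :=
    Nat.findGreatest_spec (P := fun k => (2 * k) ^ s ≤ n) h1n (by simpa using hn)
  have hk1 : 1 ≤ k := Nat.le_findGreatest h1n (by simpa using hn)
  have hk2 : n < (2 * (k + 1)) ^ s := by
    by_contra! h
    have h1 : k + 1 ≤ n := (Nat.le_self_pow hs _).trans
      ((Nat.pow_le_pow_left (by omega) s).trans h)
    exact Nat.findGreatest_is_greatest (P := fun k => (2 * k) ^ s ≤ n) (Nat.lt_succ_self k) h1 h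
  obtain ⟨p, hp, hkp, hpk⟩ := Nat.exists_prime_lt_and_le_two_mul k (by omega)
  exact ⟨p, hp, (Nat.pow_le_pow_left hpk s).trans hk,
    hk2.le.trans (Nat.pow_le_pow_left (by omega) s)⟩

theorem rpow_two_sub_inv_le (m n p : ℕ) (h : n ≤ (2 * p) ^ (m + 1)) :
    (n : ℝ) ^ ((2 : ℝ) - 1 / ((m + 1 : ℕ) : ℝ)) ≤ 2 ^ (2 * m + 1) * (p : ℝ) ^ (2 * m + 1) := by
  have h1 : (n : ℝ) ≤ (2 * p : ℝ) ^ ((m + 1 : ℕ) : ℝ) := by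
    rw [Real.rpow_natCast]; exact_mod_cast h
  have hexp : (0 : ℝ) ≤ (2 : ℝ) - 1 / ((m + 1 : ℕ) : ℝ) := by
    have : 1 / ((m + 1 : ℕ) : ℝ) ≤ 1 := by
      rw [div_le_one (by positivity)]; exact_mod_cast Nat.le_add_left 1 m
    linarith
  calc (n : ℝ) ^ ((2 : ℝ) - 1 / ((m + 1 : ℕ) : ℝ))
      ≤ ((2 * p : ℝ) ^ ((m + 1 : ℕ) : ℝ)) ^ ((2 : ℝ) - 1 / ((m + 1 : ℕ) : ℝ)) :=
        Real.rpow_le_rpow (by positivity) h1 hexp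
    _ = (2 * p : ℝ) ^ ((2 * m + 1 : ℕ) : ℝ) := by
        rw [← Real.rpow_mul (by positivity)]
        congr 1
        push_cast
        field_simp
        ring
    _ = _ := by rw [Real.rpow_natCast, mul_pow]

end Coloring

/-- Tightness of the unavoidable-pattern theorem.  For integers `s, t` with
`1 ≤ s ≤ 3 ≤ t` or `t ≥ (s-1)! + 1`, there are `c > 0` and `N` such that for every
`n ≥ N` there is a 2-edge coloring of `K_{n,n}` with at least `c·n^(2-1/s)` edges in each
color class that contains no copy of `K_{s,t}` all of whose edges are blue; consequently,
for every `T ≥ t` it contains no colored copy of `K_{T,s+T}` in which one color forms a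
`K_{T,T}` (the other forming a `K_{T,s}`) and no colored copy of `K_{s,2T}` in which one
color forms a `K_{s,T}`. -/
theorem tightness (s t : ℕ) (hs : 1 ≤ s)
    (hst : (s ≤ 3 ∧ 3 ≤ t) ∨ Nat.factorial (s - 1) + 1 ≤ t) :
    ∃ (C : ℝ) (N : ℕ), 0 < C ∧ 0 < N ∧
      ∀ n : ℕ, N ≤ n → ∃ c : Fin n → Fin n → Bool,
        C * (n : ℝ) ^ ((2 : ℝ) - 1 / (s : ℝ)) ≤ (redTotal c : ℝ) ∧
        C * (n : ℝ) ^ ((2 : ℝ) - 1 / (s : ℝ)) ≤ (blueTotal c : ℝ) ∧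
        (¬ ∃ X Y : Finset (Fin n), X.card = s ∧ Y.card = t ∧
            ((∀ x ∈ X, ∀ y ∈ Y, c x y = false) ∨ (∀ x ∈ X, ∀ y ∈ Y, c y x = false))) ∧
        (∀ T : ℕ, t ≤ T → ¬ hasPattern c T T s ∧ ¬ hasPattern c s T T) := by
  have hfac : Nat.factorial (s - 1) + 1 ≤ t := by
    rcases hst with ⟨h3, ht⟩ | h
    · have : Nat.factorial (s - 1) ≤ Nat.factorial 2 := Nat.factorial_le (by omega)
      exact (Nat.succ_le_succ this).trans ht
    · exact h
  clear hst
  obtain ⟨m, rfl⟩ : ∃ m, s = m + 1 := ⟨s - 1, by omega⟩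
  rw [Nat.add_sub_cancel] at hfac
  have hst : m + 1 ≤ t := (Nat.succ_le_succ (Nat.self_le_factorial m)).trans hfac
  refine ⟨1 / (4 * 2 ^ (2 * m + 1)), 2 ^ (m + 1), by positivity, by positivity, fun n hn => ?_⟩
  obtain ⟨p, hp, hpn, hnp⟩ := exists_prime_pow_le (m + 1) n (Nat.succ_ne_zero m) hn
  obtain ⟨c, hred, hblue, hsymm, hfree⟩ := exists_coloring p m n hp hpn
  have hbound : ∀ N : ℕ, p ^ (2 * m + 1) ≤ 4 * N →
      1 / (4 * 2 ^ (2 * m + 1)) * (n : ℝ) ^ ((2 : ℝ) - 1 / ((m + 1 : ℕ) : ℝ)) ≤ N := by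
    intro N hN
    have h1 := rpow_two_sub_inv_le m n p hnp
    have h2 : (p : ℝ) ^ (2 * m + 1) ≤ 4 * N := by exact_mod_cast hN
    rw [one_div, inv_mul_le_iff₀ (by positivity)]
    calc _ ≤ _ := h1
      _ ≤ 2 ^ (2 * m + 1) * (4 * N : ℝ) := by gcongr
      _ = _ := by ring
  have hno : ∀ X Y : Finset (Fin n), m + 1 ≤ X.card → t ≤ Y.card →
      ¬ ∀ x ∈ X, ∀ y ∈ Y, c x y = false := by
    intro X Y hX hY h
    obtain ⟨X', hX', hcard⟩ := Finset.exists_subset_card_eq hX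
    have := hfree X' Y hcard fun x hx => h x (hX' hx)
    omega
  have horient : ∀ {X Y₁ Y₂ : Finset (Fin n)} {col : Bool},
      ((∀ x ∈ X, ∀ y ∈ Y₁, c x y = col) ∧ (∀ x ∈ X, ∀ y ∈ Y₂, c x y = !col)) ∨
        ((∀ x ∈ X, ∀ y ∈ Y₁, c y x = col) ∧ (∀ x ∈ X, ∀ y ∈ Y₂, c y x = !col)) →
      (∀ x ∈ X, ∀ y ∈ Y₁, c x y = col) ∧ ∀ x ∈ X, ∀ y ∈ Y₂, c x y = !col := by
    rintro X Y₁ Y₂ col (h | h)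
    · exact h
    · exact ⟨fun x hx y hy => hsymm x y ▸ h.1 x hx y hy,
        fun x hx y hy => hsymm x y ▸ h.2 x hx y hy⟩
  refine ⟨c, hbound _ hred, hbound _ hblue, ?_, ?_⟩
  · rintro ⟨X, Y, hX, hY, h | h⟩
    · exact hno X Y hX.ge hY.ge h
    · exact hno X Y hX.ge hY.ge fun x hx y hy => hsymm x y ▸ h x hx y hy
  intro T hT
  constructor
  · rintro ⟨X, Y₁, Y₂, col, hX, hY₁, hY₂, -, h⟩
    have h' := horient h
    cases col
    · exact hno X Y₁ (by omega) (by omega) h'.1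
    · exact hno Y₂ X (by omega) (by omega) fun y hy x hx => hsymm y x ▸ h'.2 x hx y hy
  · rintro ⟨X, Y₁, Y₂, col, hX, hY₁, hY₂, -, h⟩
    have h' := horient h
    cases col
    · exact hno X Y₁ (by omega) (by omega) h'.1
    · exact hno X Y₂ (by omega) (by omega) h'.2
end

section
/- Let k ≥ 2 be an even integer and let n ≥ 2 be an integer with n > ((k−2)/2)·(k/2 − ⌊(k−2)/4⌋). Set p(n,k) = ⌊(k−2)/4⌋·n + 1 if k ≡ 0 (mod 4), and p(n,k) = ⌊(k−2)/4⌋·n if k ≡ 2 (mod 4). Then every 2-edge coloring E(K_{n,n}) = R ⊔ B with more than p(n,k) edges in each color class contains a balanced copy of the path P_k (a path with k edges having exactly k/2 red edges and k/2 blue edges) and also a balanced copy of the path P_{k+1} (a path with k+1 edges having k/2 edges in one color and k/2 + 1 edges in the other). -/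
/-- `redB c u v = true` iff `u` and `v` lie in different parts of `K_{n,n}` and the edge
between them is red (under the coloring `c : Fin n → Fin n → Bool`, where `c v w = true`
means the edge between vertex `v` of the first part and `w` of the second part is red). -/
def redB {n : ℕ} (c : Fin n → Fin n → Bool) : Fin n ⊕ Fin n → Fin n ⊕ Fin n → Bool
  | Sum.inl v, Sum.inr w => c v w
  | Sum.inr w, Sum.inl v => c v w
  | _, _ => false

/-- `blueB c u v = true` iff `u` and `v` lie in different parts of `K_{n,n}` and the edge
between them is blue. -/
def blueB {n : ℕ} (c : Fin n → Fin n → Bool) : Fin n ⊕ Fin n → Fin n ⊕ Fin n → Bool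
  | Sum.inl v, Sum.inr w => !c v w
  | Sum.inr w, Sum.inl v => !c v w
  | _, _ => false

/-- `crossB u v = true` iff `u` and `v` lie in different parts of `K_{n,n}`,
i.e. `u v` is an edge of `K_{n,n}`. -/
def crossB {n : ℕ} : Fin n ⊕ Fin n → Fin n ⊕ Fin n → Bool
  | Sum.inl _, Sum.inr _ => true
  | Sum.inr _, Sum.inl _ => true
  | _, _ => false

/-- `IsPathCopy v` says that the vertex sequence `v : Fin (ℓ+1) → Fin n ⊕ Fin n` realizes
a copy of the path `P_ℓ` with `ℓ` edges in `K_{n,n}`: the vertices are pairwise distinct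
and consecutive vertices lie in different parts (hence are adjacent in `K_{n,n}`). -/
def IsPathCopy {n ℓ : ℕ} (v : Fin (ℓ + 1) → Fin n ⊕ Fin n) : Prop :=
  Function.Injective v ∧ ∀ i : Fin ℓ, crossB (v i.castSucc) (v i.succ) = true

/-- The number of red edges of the path copy `v` in `K_{n,n}` colored by `c`. -/
def pathRedCount {n ℓ : ℕ} (c : Fin n → Fin n → Bool)
    (v : Fin (ℓ + 1) → Fin n ⊕ Fin n) : ℕ :=
  (Finset.univ.filter fun i : Fin ℓ => redB c (v i.castSucc) (v i.succ) = true).card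

/-- The number of blue edges of the path copy `v` in `K_{n,n}` colored by `c`. -/
def pathBlueCount {n ℓ : ℕ} (c : Fin n → Fin n → Bool)
    (v : Fin (ℓ + 1) → Fin n ⊕ Fin n) : ℕ :=
  (Finset.univ.filter fun i : Fin ℓ => blueB c (v i.castSucc) (v i.succ) = true).card


/-- An alternating list of distinct vertices of `K_{n,n}`, that is, a path. -/
def IsAltPath {n : ℕ} (L : List (Fin n ⊕ Fin n)) : Prop :=
  L.Nodup ∧ L.IsChain fun x y => x.isLeft ≠ y.isLeft

/-- The number of red edges along a list of vertices. -/
def listRedCount {n : ℕ} (c : Fin n → Fin n → Bool) : List (Fin n ⊕ Fin n) → ℕ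
  | x :: y :: l => (redB c x y).toNat + listRedCount c (y :: l)
  | _ => 0

/-- The red neighbours of a vertex. -/
def redNbrs {n : ℕ} (c : Fin n → Fin n → Bool) (x : Fin n ⊕ Fin n) : Finset (Fin n ⊕ Fin n) :=
  Finset.univ.filter fun y => redB c x y = true

section Basic

variable {n : ℕ} {c : Fin n → Fin n → Bool}

theorem redB_comm (x y : Fin n ⊕ Fin n) : redB c x y = redB c y x := by
  cases x <;> cases y <;> rfl

theorem isLeft_ne_of_redB {x y : Fin n ⊕ Fin n} (h : redB c x y = true) :
    x.isLeft ≠ y.isLeft := by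
  cases x <;> cases y <;> simp_all [redB]

theorem crossB_iff {x y : Fin n ⊕ Fin n} : crossB x y = true ↔ x.isLeft ≠ y.isLeft := by
  cases x <;> cases y <;> simp [crossB]

theorem redB_not (x y : Fin n ⊕ Fin n) : redB (fun v w => !c v w) x y = blueB c x y := by
  cases x <;> cases y <;> rfl

theorem redB_toNat_add_blueB_toNat {x y : Fin n ⊕ Fin n} (h : x.isLeft ≠ y.isLeft) :
    (redB c x y).toNat + (blueB c x y).toNat = 1 := by
  rcases x with v | v <;> rcases y with w | w <;> simp at h
  · cases h' : c v w <;> simp [redB, blueB, h']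
  · cases h' : c w v <;> simp [redB, blueB, h']

theorem isAltPath_cons_cons {x y : Fin n ⊕ Fin n} {l : List (Fin n ⊕ Fin n)} :
    IsAltPath (x :: y :: l) ↔ x ∉ y :: l ∧ x.isLeft ≠ y.isLeft ∧ IsAltPath (y :: l) := by
  simp only [IsAltPath, List.nodup_cons, List.isChain_cons_cons]
  tauto

theorem countP_side_of_isChain (x : Fin n ⊕ Fin n) (l : List (Fin n ⊕ Fin n))
    (h : (x :: l).IsChain fun x y => x.isLeft ≠ y.isLeft) :
    (x :: l).countP (fun y => y.isLeft == x.isLeft) = (l.length + 2) / 2 ∧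
    (x :: l).countP (fun y => y.isLeft == !x.isLeft) = (l.length + 1) / 2 := by
  induction l generalizing x with
  | nil => cases x <;> simp
  | cons y l ih =>
    rw [List.isChain_cons_cons] at h
    obtain ⟨h1, h2⟩ := ih y h.2
    have hy : y.isLeft = !x.isLeft := Bool.eq_not.2 (Ne.symm h.1)
    rw [hy] at h1
    rw [hy, Bool.not_not] at h2
    rw [List.countP_cons, List.countP_cons (a := x), h1, h2, if_pos (beq_self_eq_true _),
      if_neg (by rw [beq_iff_eq, Bool.eq_not]; exact fun h => h rfl), List.length_cons]
    omega

theorem card_filter_isLeft (b : Bool) :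
    (Finset.univ.filter fun x : Fin n ⊕ Fin n => x.isLeft = b).card = n := by
  have h : (Finset.univ.filter fun x : Fin n ⊕ Fin n => x.isLeft = b)
      = Finset.univ.image (fun i : Fin n => if b then Sum.inl i else Sum.inr i) := by
    ext x
    cases b <;> cases x <;> simp
  rw [h, Finset.card_image_of_injective, Finset.card_univ, Fintype.card_fin]
  intro i j hij
  cases b <;> simpa using hij

theorem card_toFinset_filter_le (L : List (Fin n ⊕ Fin n)) (b : Bool) :
    (L.toFinset.filter fun x => x.isLeft = b).card ≤ L.countP (fun y => y.isLeft == b) := by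
  rw [List.countP_eq_length_filter]
  refine le_trans (le_of_eq ?_) (List.toFinset_card_le _)
  congr 1
  ext x
  simp

/-- Outside a set of vertices meeting a side in fewer than `n` vertices there is a vertex
of that side. -/
theorem exists_fresh {F : Finset (Fin n ⊕ Fin n)} {b : Bool}
    (h : (F.filter fun x => x.isLeft = b).card < n) : ∃ z, z ∉ F ∧ z.isLeft = b := by
  obtain ⟨z, hz, hzF⟩ :=
    Finset.exists_mem_notMem_of_card_lt_card (h.trans_eq (card_filter_isLeft b).symm)
  simp only [Finset.mem_filter, Finset.mem_univ, true_and] at hz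
  exact ⟨z, fun hF => hzF (by simp [hF, hz]), hz⟩

theorem exists_extension {L : List (Fin n ⊕ Fin n)} (hL : IsAltPath L) (hne : L ≠ [])
    {N : ℕ} (hN : L.length ≤ N) (hNn : N ≤ 2 * n) :
    ∃ L', IsAltPath L' ∧ L'.length = N ∧ listRedCount c L ≤ listRedCount c L' := by
  induction N, hN using Nat.le_induction with
  | base => exact ⟨L, hL, rfl, le_rfl⟩
  | succ N hN ih =>
    obtain ⟨L', h1, h2, h3⟩ := ih (by omega)
    match L' with
    | [] =>
      have := List.length_pos_iff.2 hne
      simp at h2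
      omega
    | x :: l =>
      obtain ⟨z, hz, hzb⟩ := exists_fresh (F := (x :: l).toFinset) (b := !x.isLeft) (by
        have := card_toFinset_filter_le (x :: l) (!x.isLeft)
        rw [(countP_side_of_isChain x l h1.2).2] at this
        simp only [List.length_cons] at h2
        omega)
      refine ⟨z :: x :: l, isAltPath_cons_cons.2 ⟨by simpa using hz, Bool.eq_not.1 hzb, h1⟩, ?_, ?_⟩
      · simpa using h2
      · rw [listRedCount]
        omega

/-- A path avoiding `r` vertices of large red degree can be enlarged so as to collect two
red edges at each of them. -/
theorem exists_path_of_large_degrees {ℓ : ℕ} (hn : ℓ < n) (A : Finset (Fin n ⊕ Fin n))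
    (hA : ∀ y ∈ A, ℓ ≤ (redNbrs c y).card) (L : List (Fin n ⊕ Fin n)) (hL : IsAltPath L)
    (hne : L ≠ []) (hAL : ∀ y ∈ A, y ∉ L) (hlen : L.length + 4 * A.card ≤ 2 * ℓ)
    (hred : ℓ ≤ listRedCount c L + 2 * A.card) :
    ∃ L', IsAltPath L' ∧ L' ≠ [] ∧ L'.length ≤ 2 * ℓ ∧ ℓ ≤ listRedCount c L' := by
  induction A using Finset.induction_on generalizing L with
  | empty => exact ⟨L, hL, hne, by simpa using hlen, by simpa using hred⟩
  | insert y A hyA ih =>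
    rw [Finset.card_insert_of_notMem hyA] at hlen hred
    obtain ⟨h, t, rfl⟩ := List.exists_cons_of_ne_nil hne
    obtain ⟨hsame, hopp⟩ := countP_side_of_isChain h t hL.2
    have hside : ∀ b, ((h :: t).toFinset.filter fun x => x.isLeft = b).card ≤
        (t.length + 2) / 2 := by
      intro b
      refine (card_toFinset_filter_le _ b).trans ?_
      by_cases hb : b = h.isLeft
      · rw [hb, hsame]
      · rw [show b = !h.isLeft from Bool.eq_not.2 hb, hopp]
        omega
    simp only [List.length_cons] at hlen
    have hyL : y ∉ h :: t := hAL y (Finset.mem_insert_self _ _)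
    have hAL' : ∀ z ∈ A, z ∉ h :: t := fun z hz => hAL z (Finset.mem_insert_of_mem hz)
    have hcard : 1 < (redNbrs c y \ (((h :: t).toFinset.filter
        fun x => x.isLeft = !y.isLeft) ∪ A)).card := by
      have h1 := Finset.le_card_sdiff (((h :: t).toFinset.filter
        fun x => x.isLeft = !y.isLeft) ∪ A) (redNbrs c y)
      have h2 := Finset.card_union_le ((h :: t).toFinset.filter
        fun x => x.isLeft = !y.isLeft) A
      have h3 := hside (!y.isLeft)
      have h4 := hA y (Finset.mem_insert_self _ _)
      omega
    obtain ⟨x, hx, x', hx', hxx'⟩ := Finset.one_lt_card.1 hcard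
    have hleaf : ∀ x ∈ redNbrs c y \ (((h :: t).toFinset.filter
        fun x => x.isLeft = !y.isLeft) ∪ A), redB c y x = true ∧ x.isLeft ≠ y.isLeft ∧
          x ∉ h :: t ∧ x ∉ A ∧ x ≠ y := by
      intro x hx
      simp only [Finset.mem_sdiff, redNbrs, Finset.mem_filter, Finset.mem_univ, true_and,
        Finset.mem_union, not_or, List.mem_toFinset, not_and] at hx
      have h1 := isLeft_ne_of_redB hx.1
      have h2 : x.isLeft = !y.isLeft := Bool.eq_not.2 (Ne.symm h1)
      exact ⟨hx.1, Ne.symm h1, fun h3 => hx.2.1 h3 h2, hx.2.2, fun h3 => h1 (by rw [h3])⟩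
    obtain ⟨hr, hs, hxL, hxA, hxy⟩ := hleaf x hx
    obtain ⟨hr', hs', hxL', hxA', hxy'⟩ := hleaf x' hx'
    by_cases hb : h.isLeft = y.isLeft
    · refine ih (fun z hz => hA z (Finset.mem_insert_of_mem hz)) (x :: y :: x' :: h :: t)
        ?_ (by simp) ?_ (by simp only [List.length_cons]; omega) ?_
      · simp only [isAltPath_cons_cons]
        refine ⟨?_, hs, ?_, Ne.symm hs', hxL', hb ▸ hs', hL⟩
        · simpa only [List.mem_cons (b := y), List.mem_cons (b := x'), not_or]
            using ⟨hxy, hxx', hxL⟩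
        · simpa only [List.mem_cons (b := x'), not_or] using ⟨Ne.symm hxy', hyL⟩
      · intro z hz
        have := hAL' z hz
        simp only [List.mem_cons (b := x), List.mem_cons (b := y), List.mem_cons (b := x'),
          not_or]
        refine ⟨?_, ?_, ?_, this⟩ <;> rintro rfl <;> contradiction
      · simp only [listRedCount, redB_comm x y, hr, hr', Bool.toNat_true]
        omega
    · have hb' : (!h.isLeft) = y.isLeft := by
        cases h' : h.isLeft <;> cases h'' : y.isLeft <;> simp_all
      obtain ⟨z, hz, hzb⟩ := exists_fresh (F := (h :: t).toFinset ∪ insert y A)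
        (b := y.isLeft) (by
          have h1 := card_toFinset_filter_le (h :: t) (!h.isLeft)
          rw [hopp, hb'] at h1
          rw [Finset.filter_union]
          have h2 := Finset.card_union_le ((h :: t).toFinset.filter
            fun x => x.isLeft = y.isLeft) ((insert y A).filter fun x => x.isLeft = y.isLeft)
          have h3 := Finset.card_filter_le (insert y A) fun x => x.isLeft = y.isLeft
          rw [Finset.card_insert_of_notMem hyA] at h3
          omega)
      simp only [Finset.mem_union, List.mem_toFinset, Finset.mem_insert, not_or] at hz
      obtain ⟨hzL, hzy, hzA⟩ := hz
      have hzx : x ≠ z := by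
        rintro rfl
        exact hs hzb
      have hzx' : x' ≠ z := by
        rintro rfl
        exact hs' hzb
      refine ih (fun z hz => hA z (Finset.mem_insert_of_mem hz)) (x :: y :: x' :: z :: h :: t)
        ?_ (by simp) ?_ (by simp only [List.length_cons]; omega) ?_
      · simp only [isAltPath_cons_cons]
        refine ⟨?_, hs, ?_, Ne.symm hs', ?_, hzb ▸ hs', hzL, hzb ▸ Ne.symm hb, hL⟩
        · simpa only [List.mem_cons (b := y), List.mem_cons (b := x'), List.mem_cons (b := z),
            not_or] using ⟨hxy, hxx', hzx, hxL⟩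
        · simpa only [List.mem_cons (b := x'), List.mem_cons (b := z), not_or]
            using ⟨Ne.symm hxy', Ne.symm hzy, hyL⟩
        · simpa only [List.mem_cons (b := z), not_or] using ⟨hzx', hxL'⟩
      · intro w hw
        have := hAL' w hw
        simp only [List.mem_cons (b := x), List.mem_cons (b := y), List.mem_cons (b := x'),
          List.mem_cons (b := z), not_or]
        refine ⟨?_, ?_, ?_, ?_, this⟩ <;> rintro rfl <;> contradiction
      · simp only [listRedCount, redB_comm x y, hr, hr', Bool.toNat_true]
        omega

end Basic

section RedPath

variable {n : ℕ} {c : Fin n → Fin n → Bool}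

theorem card_redNbrs_le (x : Fin n ⊕ Fin n) : (redNbrs c x).card ≤ n := by
  refine (Finset.card_le_card ?_).trans_eq (card_filter_isLeft (!x.isLeft))
  intro y hy
  simp only [redNbrs, Finset.mem_filter, Finset.mem_univ, true_and] at hy ⊢
  exact Bool.eq_not.2 (isLeft_ne_of_redB hy).symm

/-- The red edges avoiding a set of vertices. -/
def redEdgesAvoiding (c : Fin n → Fin n → Bool) (A : Finset (Fin n ⊕ Fin n)) :
    Finset (Fin n × Fin n) :=
  Finset.univ.filter fun p => c p.1 p.2 = true ∧ Sum.inl p.1 ∉ A ∧ Sum.inr p.2 ∉ A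

theorem redTotal_le_sum_add_card (A : Finset (Fin n ⊕ Fin n)) :
    redTotal c ≤ ∑ x ∈ A, (redNbrs c x).card + (redEdgesAvoiding c A).card := by
  classical
  let E : Fin n ⊕ Fin n → Finset (Fin n × Fin n) := fun x =>
    Finset.univ.filter fun p => c p.1 p.2 = true ∧ (Sum.inl p.1 = x ∨ Sum.inr p.2 = x)
  have hE : ∀ x, (E x).card ≤ (redNbrs c x).card := by
    rintro (v | w)
    · refine Finset.card_le_card_of_injOn (fun p => Sum.inr p.2) ?_ ?_
      · rintro ⟨v', w⟩ h
        simp [E, redNbrs] at h ⊢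
        obtain ⟨h, rfl⟩ := h
        simpa [redB] using h
      · rintro ⟨v', w⟩ h ⟨v'', w'⟩ h'
        simp [E] at h h' ⊢
        rw [h.2, h'.2]
        simp
    · refine Finset.card_le_card_of_injOn (fun p => Sum.inl p.1) ?_ ?_
      · rintro ⟨v, w'⟩ h
        simp [E, redNbrs] at h ⊢
        obtain ⟨h, rfl⟩ := h
        simpa [redB] using h
      · rintro ⟨v', w⟩ h ⟨v'', w'⟩ h'
        simp [E] at h h' ⊢
        rw [h.2, h'.2]
        simp
  have hsub : (Finset.univ.filter fun p : Fin n × Fin n => c p.1 p.2 = true) ⊆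
      A.biUnion E ∪ redEdgesAvoiding c A := by
    rintro ⟨v, w⟩ h
    simp only [Finset.mem_filter, Finset.mem_univ, true_and] at h
    simp only [Finset.mem_union, Finset.mem_biUnion, E, redEdgesAvoiding, Finset.mem_filter,
      Finset.mem_univ, true_and, h]
    by_cases hv : Sum.inl v ∈ A
    · exact Or.inl ⟨_, hv, Or.inl rfl⟩
    · by_cases hw : Sum.inr w ∈ A
      · exact Or.inl ⟨_, hw, Or.inr rfl⟩
      · exact Or.inr ⟨hv, hw⟩
  calc redTotal c ≤ (A.biUnion E ∪ redEdgesAvoiding c A).card := Finset.card_le_card hsub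
    _ ≤ (A.biUnion E).card + (redEdgesAvoiding c A).card := Finset.card_union_le _ _
    _ ≤ _ := by
      gcongr
      exact Finset.card_biUnion_le.trans (Finset.sum_le_sum fun x _ => hE x)

/-- Kőnig's theorem: a bipartite graph has a matching with `ℓ` edges or a vertex cover with
fewer than `ℓ` vertices. -/
theorem exists_matching_or_cover (c : Fin n → Fin n → Bool) {ℓ : ℕ} (hℓ : ℓ ≤ n) :
    (∃ (S : Finset (Fin n)) (g : Fin n → Fin n), S.card = ℓ ∧ Set.InjOn g S ∧
      ∀ v ∈ S, c v (g v) = true) ∨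
    ∃ C : Finset (Fin n ⊕ Fin n), C.card < ℓ ∧
      ∀ v w, c v w = true → Sum.inl v ∈ C ∨ Sum.inr w ∈ C := by
  classical
  let t : Fin n → Finset (Fin n ⊕ Fin (n - ℓ)) := fun v =>
    (Finset.univ.filter fun w => c v w = true).disjSum Finset.univ
  by_cases hall : ∀ s : Finset (Fin n), s.card ≤ (s.biUnion t).card
  · left
    obtain ⟨f, hf, hft⟩ := (Finset.all_card_le_biUnion_card_iff_exists_injective t).1 hall
    have h1 : (Finset.univ.filter fun v => ¬ (f v).isLeft = true).card ≤ n - ℓ := by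
      rw [← Finset.card_image_of_injective _ hf]
      refine (Finset.card_le_card (t := Finset.univ.map Function.Embedding.inr) ?_).trans ?_
      · intro x hx
        simp only [Finset.mem_image, Finset.mem_filter] at hx
        obtain ⟨v, hv, rfl⟩ := hx
        cases h : f v <;> simp_all
      · simp
    have h2 := Finset.card_filter_add_card_filter_not (s := Finset.univ)
      fun v => (f v).isLeft = true
    rw [Finset.card_univ, Fintype.card_fin] at h2
    obtain ⟨S, hS, hSc⟩ := Finset.exists_subset_card_eq
      (s := Finset.univ.filter fun v => (f v).isLeft = true) (n := ℓ) (by omega)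
    have hS' : ∀ v ∈ S, ∃ w, f v = Sum.inl w := by
      intro v hv
      have := hS hv
      simp only [Finset.mem_filter, Finset.mem_univ, true_and] at this
      exact Sum.isLeft_iff.1 this
    refine ⟨S, fun v => Sum.elim id (fun _ => v) (f v), hSc, ?_, ?_⟩
    · intro v hv v' hv' h
      obtain ⟨w, hw⟩ := hS' v hv
      obtain ⟨w', hw'⟩ := hS' v' hv'
      simp only [hw, hw', Sum.elim_inl, id] at h
      exact hf (by rw [hw, hw', h])
    · intro v hv
      obtain ⟨w, hw⟩ := hS' v hv
      have := hft v
      simp only [hw] at this ⊢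
      simpa [t] using this
  · right
    push Not at hall
    obtain ⟨s, hs⟩ := hall
    have hne : s.Nonempty := Finset.card_pos.1 (by omega)
    obtain ⟨v₀, hv₀⟩ := hne
    let N : Finset (Fin n) := Finset.univ.filter fun w => ∃ v ∈ s, c v w = true
    have hsub : N.disjSum Finset.univ ⊆ s.biUnion t := by
      rintro (w | d) hx
      · simpa [N, t] using hx
      · simpa [t] using ⟨v₀, hv₀⟩
    have h1 := Finset.card_le_card hsub
    rw [Finset.card_disjSum, Finset.card_univ, Fintype.card_fin] at h1
    have h2 := Finset.card_compl s
    have h3 := Finset.card_le_univ s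
    rw [Fintype.card_fin] at h2 h3
    refine ⟨sᶜ.disjSum N, by rw [Finset.card_disjSum]; omega, fun v w hvw => ?_⟩
    by_cases hv : v ∈ s
    · exact Or.inr (by simpa [N] using ⟨v, hv, hvw⟩)
    · exact Or.inl (by simpa using hv)

theorem exists_path_of_matching (S : Finset (Fin n)) (g : Fin n → Fin n)
    (hg : Set.InjOn g S) (hS : ∀ v ∈ S, c v (g v) = true) :
    ∃ L : List (Fin n ⊕ Fin n), IsAltPath L ∧ L.length = 2 * S.card ∧
      S.card ≤ listRedCount c L ∧ (∀ x ∈ L, ∃ v ∈ S, x = Sum.inl v ∨ x = Sum.inr (g v)) ∧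
      ∀ x ∈ L.head?, x.isLeft = true := by
  induction S using Finset.induction_on with
  | empty => exact ⟨[], ⟨List.nodup_nil, List.isChain_nil⟩, rfl, le_rfl, by simp, by simp⟩
  | insert v S hv ih =>
    obtain ⟨L, h1, h2, h3, h4, h5⟩ := ih
      (hg.mono (by simp)) fun w hw => hS w (Finset.mem_insert_of_mem hw)
    have hr : redB c (Sum.inl v) (Sum.inr (g v)) = true := hS v (Finset.mem_insert_self _ _)
    have hvL : Sum.inl v ∉ L := by
      intro h
      obtain ⟨w, hw, h | h⟩ := h4 _ h
      · exact hv (Sum.inl_injective h ▸ hw)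
      · simp at h
    have hgL : Sum.inr (g v) ∉ L := by
      intro h
      obtain ⟨w, hw, h | h⟩ := h4 _ h
      · simp at h
      · have := hg (by simp) (by simp [hw]) (Sum.inr_injective h)
        exact hv (this ▸ hw)
    refine ⟨Sum.inl v :: Sum.inr (g v) :: L, ?_, ?_, ?_, ?_, by simp⟩
    · refine isAltPath_cons_cons.2 ⟨by simpa using hvL, by simp, ?_⟩
      cases L with
      | nil => exact ⟨by simp, by simp⟩
      | cons y l =>
        refine isAltPath_cons_cons.2 ⟨hgL, ?_, h1⟩
        have := h5 y (by simp)
        simp [this]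
    · simp only [List.length_cons, Finset.card_insert_of_notMem hv, h2]
      ring
    · rw [Finset.card_insert_of_notMem hv, listRedCount, hr]
      have : listRedCount c L ≤ listRedCount c (Sum.inr (g v) :: L) := by
        cases L with
        | nil => simp [listRedCount]
        | cons y l =>
          rw [listRedCount.eq_1 c (Sum.inr (g v))]
          omega
      simp only [Bool.toNat_true]
      omega
    · intro x hx
      simp only [List.mem_cons] at hx
      rcases hx with rfl | rfl | hx
      · exact ⟨v, by simp⟩
      · exact ⟨v, by simp⟩
      · obtain ⟨w, hw, h⟩ := h4 x hx
        exact ⟨w, Finset.mem_insert_of_mem hw, h⟩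

/-- Two red edges form a path with at most four vertices, after adding an edge if needed. -/
theorem exists_path_of_two_edges {p q : Fin n × Fin n} (hpq : p ≠ q) (hp : c p.1 p.2 = true)
    (hq : c q.1 q.2 = true) :
    ∃ L : List (Fin n ⊕ Fin n), IsAltPath L ∧ L ≠ [] ∧ L.length ≤ 4 ∧ 2 ≤ listRedCount c L ∧
      ∀ x ∈ L, x ∈ [Sum.inl p.1, Sum.inr p.2, Sum.inl q.1, Sum.inr q.2] := by
  obtain ⟨v, w⟩ := p
  obtain ⟨v', w'⟩ := q
  simp only at hp hq
  by_cases hv : v = v'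
  · subst hv
    have hw : w ≠ w' := fun h => hpq (by rw [h])
    refine ⟨[Sum.inr w, Sum.inl v, Sum.inr w'], ?_, by simp, by simp, ?_, by simp⟩
    · simp [IsAltPath, hw]
    · simp [listRedCount, redB, hp, hq]
  · by_cases hw : w = w'
    · subst hw
      refine ⟨[Sum.inl v, Sum.inr w, Sum.inl v'], ?_, by simp, by simp, ?_, by simp⟩
      · simp [IsAltPath, hv]
      · simp [listRedCount, redB, hp, hq]
    · refine ⟨[Sum.inl v, Sum.inr w, Sum.inl v', Sum.inr w'], ?_, by simp, by simp, ?_, by simp⟩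
      · simp [IsAltPath, hv, hw]
      · simp [listRedCount, redB, hp, hq]
        omega

theorem exists_red_path {ℓ : ℕ} (hℓ : 1 ≤ ℓ) (hℓn : ℓ < n)
    (hn : (ℓ - 1) * (ℓ - (ℓ - 1) / 2) < n)
    (hR : (if ℓ % 2 = 0 then (ℓ - 1) / 2 * n + 1 else (ℓ - 1) / 2 * n) < redTotal c) :
    ∃ L : List (Fin n ⊕ Fin n), IsAltPath L ∧ L.length = 2 * ℓ + 1 ∧
      ℓ ≤ listRedCount c L := by
  suffices h : ∃ L : List (Fin n ⊕ Fin n), IsAltPath L ∧ L ≠ [] ∧ L.length ≤ 2 * ℓ ∧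
      ℓ ≤ listRedCount c L by
    obtain ⟨L, h1, h2, h3, h4⟩ := h
    obtain ⟨L', h5, h6, h7⟩ := exists_extension (c := c) h1 h2 (N := 2 * ℓ + 1)
      (by omega) (by omega)
    exact ⟨L', h5, h6, h4.trans h7⟩
  obtain ⟨S, g, hS, hg, hSg⟩ | ⟨C, hC, hcov⟩ := exists_matching_or_cover c hℓn.le
  · obtain ⟨L, h1, h2, h3, -⟩ := exists_path_of_matching (c := c) S g hg hSg
    rw [hS] at h2 h3
    refine ⟨L, h1, ?_, h2.le, h3⟩
    rintro rfl
    simp at h2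
    omega
  set a := (ℓ - 1) / 2 with ha
  let H := C.filter fun x => ℓ ≤ (redNbrs c x).card
  have hH : a ≤ H.card := by
    by_contra! hlt
    have h1 := redTotal_le_sum_add_card (c := c) C
    have h2 : redEdgesAvoiding c C = ∅ := by
      ext ⟨v, w⟩
      simp only [redEdgesAvoiding, Finset.mem_filter, Finset.mem_univ, true_and,
        Finset.notMem_empty, iff_false]
      rintro ⟨h, hv, hw⟩
      exact (hcov v w h).elim hv hw
    rw [h2, Finset.card_empty, add_zero, ← Finset.sum_filter_add_sum_filter_not C
      fun x => ℓ ≤ (redNbrs c x).card] at h1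
    have h3 : ∑ x ∈ H, (redNbrs c x).card ≤ H.card * n := by
      simpa using Finset.sum_le_card_nsmul H _ n fun x _ => card_redNbrs_le x
    have h4 : ∑ x ∈ C.filter (fun x => ¬ ℓ ≤ (redNbrs c x).card), (redNbrs c x).card ≤
        (C.filter fun x => ¬ ℓ ≤ (redNbrs c x).card).card * (ℓ - 1) := by
      refine Finset.sum_le_card_nsmul _ _ _ fun x hx => ?_
      have := (Finset.mem_filter.1 hx).2
      omega
    have h5 : H.card + (C.filter fun x => ¬ ℓ ≤ (redNbrs c x).card).card = C.card :=
      Finset.card_filter_add_card_filter_not _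
    have h6 : a * n < redTotal c := by
      split_ifs at hR <;> omega
    set h := H.card
    set m := (C.filter fun x => ¬ ℓ ≤ (redNbrs c x).card).card
    obtain ⟨s, hs⟩ : ∃ s, a = h + 1 + s := ⟨a - h - 1, by omega⟩
    have h7 : m ≤ (ℓ - a) + s := by omega
    have h8 : m * (ℓ - 1) ≤ (ℓ - 1) * (ℓ - a) + s * n := by
      calc m * (ℓ - 1) ≤ ((ℓ - a) + s) * (ℓ - 1) := by gcongr
        _ = (ℓ - 1) * (ℓ - a) + s * (ℓ - 1) := by ring
        _ ≤ _ := by gcongr; omega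
    have h9 : a * n = h * n + n + s * n := by rw [hs]; ring
    change _ ≤ ∑ x ∈ H, _ + _ at h1
    omega
  obtain ⟨A, hAH, hA⟩ := Finset.exists_subset_card_eq hH
  have hdeg : ∀ y ∈ A, ℓ ≤ (redNbrs c y).card := fun y hy => (Finset.mem_filter.1 (hAH hy)).2
  have hcount := redTotal_le_sum_add_card (c := c) A
  have hsum : ∑ x ∈ A, (redNbrs c x).card ≤ a * n := by
    simpa [hA] using Finset.sum_le_card_nsmul A _ n fun x _ => card_redNbrs_le x
  have hav : ∀ p ∈ redEdgesAvoiding c A,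
      c p.1 p.2 = true ∧ Sum.inl p.1 ∉ A ∧ Sum.inr p.2 ∉ A := fun p hp =>
    (Finset.mem_filter.1 hp).2
  by_cases hpar : ℓ % 2 = 0
  · rw [if_pos hpar] at hR
    obtain ⟨p, hp, q, hq, hpq⟩ := Finset.one_lt_card.1 (show 1 < (redEdgesAvoiding c A).card by
      omega)
    obtain ⟨hp1, hp2, hp3⟩ := hav p hp
    obtain ⟨hq1, hq2, hq3⟩ := hav q hq
    obtain ⟨L, h1, h2, h3, h4, h5⟩ := exists_path_of_two_edges hpq hp1 hq1
    refine exists_path_of_large_degrees hℓn A hdeg L h1 h2 ?_ (by omega) (by omega)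
    intro y hy hyL
    have := h5 y hyL
    simp only [List.mem_cons, List.not_mem_nil, or_false] at this
    rcases this with rfl | rfl | rfl | rfl <;> contradiction
  · rw [if_neg hpar] at hR
    obtain ⟨⟨v, w⟩, hp⟩ := Finset.card_pos.1 (show 0 < (redEdgesAvoiding c A).card by omega)
    obtain ⟨hp1, hp2, hp3⟩ := hav _ hp
    refine exists_path_of_large_degrees hℓn A hdeg [Sum.inl v, Sum.inr w] ?_ (by simp) ?_
      (by simp; omega) ?_
    · simp [IsAltPath]
    · intro y hy hyL
      simp only [List.mem_cons, List.not_mem_nil, or_false] at hyL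
      rcases hyL with rfl | rfl <;> contradiction
    · simp only at hp1
      simp [listRedCount, redB, hp1]
      omega

end RedPath

section Windows

variable {n : ℕ} {c : Fin n → Fin n → Bool}

/-- The number of red edges among the `2 * ℓ` edges following position `j` in a sequence of
vertices. -/
def windowRed (c : Fin n → Fin n → Bool) (u : ℕ → Fin n ⊕ Fin n) (ℓ j : ℕ) : ℕ :=
  ∑ i ∈ Finset.range (2 * ℓ), (redB c (u (j + i)) (u (j + i + 1))).toNat

theorem windowRed_congr {u u' : ℕ → Fin n ⊕ Fin n} {ℓ j : ℕ}
    (h : ∀ t, j ≤ t → t ≤ j + 2 * ℓ → u t = u' t) : windowRed c u ℓ j = windowRed c u' ℓ j := by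
  refine Finset.sum_congr rfl fun i hi => ?_
  rw [Finset.mem_range] at hi
  rw [h _ (by omega) (by omega), h _ (by omega) (by omega)]

theorem windowRed_succ (u : ℕ → Fin n ⊕ Fin n) (ℓ j : ℕ) :
    windowRed c u ℓ (j + 1) + (redB c (u j) (u (j + 1))).toNat =
      windowRed c u ℓ j + (redB c (u (j + 2 * ℓ)) (u (j + 2 * ℓ + 1))).toNat := by
  have h1 := Finset.sum_range_succ
    (fun i => (redB c (u (j + i)) (u (j + i + 1))).toNat) (2 * ℓ)
  have h2 := Finset.sum_range_succ'
    (fun i => (redB c (u (j + i)) (u (j + i + 1))).toNat) (2 * ℓ)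
  have h3 : windowRed c u ℓ (j + 1) = ∑ i ∈ Finset.range (2 * ℓ),
      (redB c (u (j + (i + 1))) (u (j + (i + 1) + 1))).toNat :=
    Finset.sum_congr rfl fun i _ => by rw [add_right_comm, ← add_assoc]
  rw [h1] at h2
  rw [h3, windowRed, h2]
  rfl

/-- Consecutive windows differ by at most one red edge, so that windows without exactly `ℓ` red
edges are all on the same side of `ℓ`. -/
theorem windowRed_lt_iff {u : ℕ → Fin n ⊕ Fin n} {ℓ : ℕ} (h : ∀ j, windowRed c u ℓ j ≠ ℓ)
    (j : ℕ) : windowRed c u ℓ j < ℓ ↔ windowRed c u ℓ 0 < ℓ := by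
  induction j with
  | zero => rfl
  | succ j ih =>
    rw [← ih]
    have h1 := windowRed_succ (c := c) u ℓ j
    have h2 := Bool.toNat_le (redB c (u j) (u (j + 1)))
    have h3 := Bool.toNat_le (redB c (u (j + 2 * ℓ)) (u (j + 2 * ℓ + 1)))
    have h4 := h j
    have h5 := h (j + 1)
    omega

theorem isPathCopy_of_seq {u : ℕ → Fin n ⊕ Fin n} {N j : ℕ}
    (hinj : ∀ t t', j ≤ t → t ≤ j + N → j ≤ t' → t' ≤ j + N → u t = u t' → t = t')
    (halt : ∀ t, (u t).isLeft ≠ (u (t + 1)).isLeft) :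
    IsPathCopy fun i : Fin (N + 1) => u (j + i) := by
  refine ⟨fun i i' h => ?_, fun i => crossB_iff.2 ?_⟩
  · have := hinj _ _ (by omega) (by omega) (by omega) (by omega) h
    exact Fin.ext (by omega)
  · simpa [add_assoc] using halt (j + i)

theorem pathRedCount_seq (u : ℕ → Fin n ⊕ Fin n) (N j : ℕ) :
    pathRedCount c (fun i : Fin (N + 1) => u (j + i)) =
      ∑ i ∈ Finset.range N, (redB c (u (j + i)) (u (j + i + 1))).toNat := by
  rw [pathRedCount, Finset.card_filter,
    ← Fin.sum_univ_eq_sum_range fun i => (redB c (u (j + i)) (u (j + i + 1))).toNat]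
  refine Finset.sum_congr rfl fun i _ => ?_
  simp only [Fin.val_castSucc, Fin.val_succ, add_assoc]
  split_ifs with h <;> simp [h]

theorem pathBlueCount_seq (u : ℕ → Fin n ⊕ Fin n) (N j : ℕ) :
    pathBlueCount c (fun i : Fin (N + 1) => u (j + i)) =
      ∑ i ∈ Finset.range N, (blueB c (u (j + i)) (u (j + i + 1))).toNat := by
  simp_rw [← redB_not]
  rw [← pathRedCount_seq]
  simp only [pathRedCount, pathBlueCount, redB_not]

/-- A window with exactly `ℓ` red edges provides the two balanced paths. -/
theorem balanced_paths_of_windowRed_eq {u : ℕ → Fin n ⊕ Fin n} {ℓ j : ℕ}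
    (hinj : ∀ t t', j ≤ t → t < j + 2 * (ℓ + 1) → j ≤ t' → t' < j + 2 * (ℓ + 1) →
      u t = u t' → t = t')
    (halt : ∀ t, (u t).isLeft ≠ (u (t + 1)).isLeft) (h : windowRed c u ℓ j = ℓ) :
    (∃ v : Fin (2 * ℓ + 1) → Fin n ⊕ Fin n, IsPathCopy v ∧
        pathRedCount c v = ℓ ∧ pathBlueCount c v = ℓ) ∧
      (∃ v : Fin (2 * ℓ + 1 + 1) → Fin n ⊕ Fin n, IsPathCopy v ∧
        ((pathRedCount c v = ℓ ∧ pathBlueCount c v = ℓ + 1) ∨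
         (pathRedCount c v = ℓ + 1 ∧ pathBlueCount c v = ℓ))) := by
  have hblue : ∑ i ∈ Finset.range (2 * ℓ), (blueB c (u (j + i)) (u (j + i + 1))).toNat = ℓ := by
    have h1 : windowRed c u ℓ j +
        ∑ i ∈ Finset.range (2 * ℓ), (blueB c (u (j + i)) (u (j + i + 1))).toNat = 2 * ℓ := by
      rw [windowRed, ← Finset.sum_add_distrib, Finset.sum_congr rfl fun i _ =>
        redB_toNat_add_blueB_toNat (c := c) (halt (j + i))]
      simp
    omega
  refine ⟨⟨fun i => u (j + i), ?_, ?_, ?_⟩, ⟨fun i => u (j + i), ?_, ?_⟩⟩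
  · exact isPathCopy_of_seq (fun t t' h1 h2 h3 h4 => hinj t t' h1 (by omega) h3 (by omega)) halt
  · rw [pathRedCount_seq, ← windowRed, h]
  · rw [pathBlueCount_seq, hblue]
  · exact isPathCopy_of_seq (fun t t' h1 h2 h3 h4 => hinj t t' h1 (by omega) h3 (by omega)) halt
  · rw [pathRedCount_seq, pathBlueCount_seq, Finset.sum_range_succ, Finset.sum_range_succ,
      ← windowRed, h, hblue]
    have := redB_toNat_add_blueB_toNat (c := c) (halt (j + 2 * ℓ))
    omega

end Windows

section Cycles

variable {n m : ℕ} {c : Fin n → Fin n → Bool}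

/-- The alternating closed sequence of vertices of `K_{n,n}` with period `2 * m` through the
images of the first `m` vertices of each side. -/
def cycleSeq (hm : 0 < m) (hmn : m ≤ n) (σ τ : Equiv.Perm (Fin n)) (t : ℕ) : Fin n ⊕ Fin n :=
  if t % 2 = 0 then Sum.inl (σ ⟨t / 2 % m, (Nat.mod_lt _ hm).trans_le hmn⟩)
  else Sum.inr (τ ⟨t / 2 % m, (Nat.mod_lt _ hm).trans_le hmn⟩)

theorem cycleSeq_isLeft_ne (hm : 0 < m) (hmn : m ≤ n) (σ τ : Equiv.Perm (Fin n)) (t : ℕ) :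
    (cycleSeq hm hmn σ τ t).isLeft ≠ (cycleSeq hm hmn σ τ (t + 1)).isLeft := by
  unfold cycleSeq
  split_ifs <;> first | omega | simp

theorem eq_of_mod_eq_of_lt {a b i : ℕ} (ha : i ≤ a) (ha' : a < i + m) (hb : i ≤ b)
    (hb' : b < i + m) (h : a % m = b % m) : a = b := by
  have h1 : (i + (a - i)) ≡ (i + (b - i)) [MOD m] := by
    rwa [Nat.add_sub_cancel' ha, Nat.add_sub_cancel' hb]
  have := (Nat.ModEq.add_left_cancel' i h1).eq_of_lt_of_lt (by omega) (by omega)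
  omega

theorem cycleSeq_injOn (hm : 0 < m) (hmn : m ≤ n) (σ τ : Equiv.Perm (Fin n)) {j t t' : ℕ}
    (h1 : j ≤ t) (h2 : t < j + 2 * m) (h3 : j ≤ t') (h4 : t' < j + 2 * m)
    (h : cycleSeq hm hmn σ τ t = cycleSeq hm hmn σ τ t') : t = t' := by
  unfold cycleSeq at h
  have key : t % 2 = t' % 2 → t / 2 % m = t' / 2 % m → t = t' := by
    intro hp hq
    have := eq_of_mod_eq_of_lt (i := (j + (j + t) % 2) / 2) (by omega) (by omega) (by omega)
      (by omega) hq
    omega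
  split_ifs at h with hp hp' hp'
  · exact key (by omega) (by simpa using h)
  · exact key (by omega) (by simpa using h)

theorem swap_apply_mod {i s : Fin n} {q : ℕ} (hs : m ≤ s.val) (h1 : i.val < q)
    (h2 : q < i.val + m) (hq : q % m < n) :
    Equiv.swap i s ⟨q % m, hq⟩ = ⟨q % m, hq⟩ := by
  have hlt : q % m < m := Nat.mod_lt _ (by omega)
  refine Equiv.swap_apply_of_ne_of_ne (fun h => ?_) fun h => ?_
  · have he : q % m = i := congrArg Fin.val h
    have := eq_of_mod_eq_of_lt (m := m) (a := q) (b := i) (i := i) h1.le h2 le_rfl (by omega)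
      (by rw [← he, Nat.mod_mod])
    omega
  · have he : q % m = s := congrArg Fin.val h
    omega

/-- If no window is balanced, then replacing a vertex of the first side by one outside the
cycle does not change the majority colour. -/
theorem windowRed_lt_iff_mul_swap_left {ℓ : ℕ} (hmn : ℓ + 1 ≤ n)
    (h : ∀ σ τ j, windowRed c (cycleSeq ℓ.succ_pos hmn σ τ) ℓ j ≠ ℓ)
    (σ τ : Equiv.Perm (Fin n)) (i s : Fin n) (hs : ℓ + 1 ≤ s.val) :
    windowRed c (cycleSeq ℓ.succ_pos hmn (σ * Equiv.swap i s) τ) ℓ 0 < ℓ ↔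
      windowRed c (cycleSeq ℓ.succ_pos hmn σ τ) ℓ 0 < ℓ := by
  rw [← windowRed_lt_iff (h _ _) (2 * i + 1), ← windowRed_lt_iff (h σ τ) (2 * i + 1),
    windowRed_congr]
  intro t h1 h2
  unfold cycleSeq
  split_ifs with ht
  · rw [Equiv.Perm.mul_apply, swap_apply_mod hs (by omega) (by omega)]
  · rfl

theorem windowRed_lt_iff_mul_swap_right {ℓ : ℕ} (hmn : ℓ + 1 ≤ n)
    (h : ∀ σ τ j, windowRed c (cycleSeq ℓ.succ_pos hmn σ τ) ℓ j ≠ ℓ)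
    (σ τ : Equiv.Perm (Fin n)) (i s : Fin n) (hs : ℓ + 1 ≤ s.val) :
    windowRed c (cycleSeq ℓ.succ_pos hmn σ (τ * Equiv.swap i s)) ℓ 0 < ℓ ↔
      windowRed c (cycleSeq ℓ.succ_pos hmn σ τ) ℓ 0 < ℓ := by
  rw [← windowRed_lt_iff (h _ _) (2 * i + 2), ← windowRed_lt_iff (h σ τ) (2 * i + 2),
    windowRed_congr]
  intro t h1 h2
  unfold cycleSeq
  split_ifs with ht
  · rfl
  · rw [Equiv.Perm.mul_apply, swap_apply_mod hs (by omega) (by omega)]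

/-- A property of permutations invariant under the transpositions moving `s` is constant. -/
theorem perm_iff_one_of_swap {P : Equiv.Perm (Fin n) → Prop} (s : Fin n)
    (hP : ∀ σ i, P (σ * Equiv.swap i s) ↔ P σ) (σ : Equiv.Perm (Fin n)) : P σ ↔ P 1 := by
  induction σ using Equiv.Perm.swap_induction_on' with
  | one => rfl
  | mul_swap f x y hxy ih =>
    rw [← ih]
    by_cases hx : x = s
    · rw [hx, Equiv.swap_comm, hP]
    by_cases hy : y = s
    · rw [hy, hP]
    rw [← Equiv.swap_mul_swap_mul_swap (x := y) (y := s) (z := x) hy hxy.symm,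
      Equiv.swap_comm s x, ← mul_assoc, ← mul_assoc, hP, hP, hP]

theorem windowRed_lt_iff_of_perm {ℓ : ℕ} (hn : ℓ + 1 < n)
    (h : ∀ σ τ j, windowRed c (cycleSeq ℓ.succ_pos hn.le σ τ) ℓ j ≠ ℓ)
    (σ τ : Equiv.Perm (Fin n)) (j : ℕ) :
    windowRed c (cycleSeq ℓ.succ_pos hn.le σ τ) ℓ j < ℓ ↔
      windowRed c (cycleSeq ℓ.succ_pos hn.le 1 1) ℓ 0 < ℓ := by
  rw [windowRed_lt_iff (h σ τ) j, perm_iff_one_of_swap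
    (P := fun σ => windowRed c (cycleSeq ℓ.succ_pos hn.le σ τ) ℓ 0 < ℓ) ⟨ℓ + 1, hn⟩
    (fun σ i => windowRed_lt_iff_mul_swap_left hn.le h σ τ i _ le_rfl) σ]
  exact perm_iff_one_of_swap
    (P := fun τ => windowRed c (cycleSeq ℓ.succ_pos hn.le 1 τ) ℓ 0 < ℓ) ⟨ℓ + 1, hn⟩
    (fun τ i => windowRed_lt_iff_mul_swap_right hn.le h 1 τ i _ le_rfl) τ

theorem exists_perm_extending {s : Finset (Fin n)} {f : Fin n → Fin n} (hf : Set.InjOn f s) :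
    ∃ σ : Equiv.Perm (Fin n), ∀ i ∈ s, σ i = f i := by
  obtain ⟨g, hg⟩ := Finset.exists_equiv_extend_of_card_eq (t := Finset.univ) (by simp)
    (Finset.subset_univ (s.image f)) hf
  exact ⟨g.trans (Equiv.subtypeUnivEquiv fun _ => Finset.mem_univ _), hg⟩

theorem listRedCount_eq_sum (x d : Fin n ⊕ Fin n) (l : List (Fin n ⊕ Fin n)) :
    listRedCount c (x :: l) = ∑ i ∈ Finset.range l.length,
      (redB c ((x :: l).getD i d) ((x :: l).getD (i + 1) d)).toNat := by
  induction l generalizing x with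
  | nil => rfl
  | cons y l ih =>
    rw [listRedCount, ih, List.length_cons, Finset.sum_range_succ', add_comm]
    rfl

theorem isLeft_getElem_of_isChain {L : List (Fin n ⊕ Fin n)}
    (hL : L.IsChain fun x y => x.isLeft ≠ y.isLeft) {b : ℕ} (h0 : 0 < L.length)
    (hb : L[0].isLeft = decide (b % 2 = 0)) (i : ℕ) (hi : i < L.length) :
    L[i].isLeft = decide ((b + i) % 2 = 0) := by
  induction i with
  | zero => exact hb
  | succ i ih =>
    rw [Bool.eq_not.2 (hL.getElem i hi).symm, ih (by omega), ← decide_not, decide_eq_decide]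
    omega

/-- Every path with `2 * ℓ` edges is a window of some cycle. -/
theorem exists_windowRed_eq_listRedCount {ℓ : ℕ} (hmn : ℓ + 1 ≤ n)
    {L : List (Fin n ⊕ Fin n)} (hL : IsAltPath L) (hlen : L.length = 2 * ℓ + 1) :
    ∃ σ τ j, windowRed c (cycleSeq ℓ.succ_pos hmn σ τ) ℓ j = listRedCount c L := by
  obtain ⟨b, hb1, hb⟩ : ∃ b ≤ 1, L[0].isLeft = decide (b % 2 = 0) := by
    by_cases h : L[0].isLeft = true
    · exact ⟨0, by omega, by simp [h]⟩
    · exact ⟨1, le_rfl, by simpa using h⟩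
  have hside := isLeft_getElem_of_isChain hL.2 (by omega) hb
  let U : ℕ → Fin n ⊕ Fin n := fun t => L.getD (t - b) L[0]
  have hU : ∀ t (_ : b ≤ t) (h2 : t ≤ b + 2 * ℓ), U t = L[t - b] := fun t _ h2 =>
    (List.getElem_eq_getD _).symm
  have hUside : ∀ t, b ≤ t → t ≤ b + 2 * ℓ → (U t).isLeft = decide (t % 2 = 0) := by
    intro t h1 h2
    rw [hU t h1 h2, hside, Nat.add_sub_cancel' h1]
  have hUinj : ∀ t t', b ≤ t → t ≤ b + 2 * ℓ → b ≤ t' → t' ≤ b + 2 * ℓ → U t = U t' →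
      t = t' := by
    intro t t' h1 h2 h3 h4 h
    rw [hU t h1 h2, hU t' h3 h4, hL.1.getElem_inj_iff] at h
    omega
  have hl : ∀ t, b ≤ t → t ≤ b + 2 * ℓ → t % 2 = 0 → ∃ v, U t = Sum.inl v := by
    intro t h1 h2 h3
    exact Sum.isLeft_iff.1 (by simp [hUside t h1 h2, h3])
  have hr : ∀ t, b ≤ t → t ≤ b + 2 * ℓ → ¬ t % 2 = 0 → ∃ v, U t = Sum.inr v := by
    intro t h1 h2 h3
    exact Sum.isRight_iff.1 (by rw [← Sum.not_isLeft, hUside t h1 h2]; simpa using h3)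
  obtain ⟨σ, hσ⟩ := exists_perm_extending
    (s := Finset.univ.filter fun i : Fin n => b ≤ 2 * i.val ∧ 2 * i.val ≤ b + 2 * ℓ)
    (f := fun i => (U (2 * i)).elim id fun _ => i) (by
      intro i hi i' hi' h
      simp only [Finset.coe_filter, Finset.mem_univ, true_and, Set.mem_ofPred_eq] at hi hi'
      obtain ⟨v, hv⟩ := hl _ hi.1 hi.2 (by omega)
      obtain ⟨v', hv'⟩ := hl _ hi'.1 hi'.2 (by omega)
      simp only [hv, hv', Sum.elim_inl, id] at h
      have := hUinj _ _ hi.1 hi.2 hi'.1 hi'.2 (by rw [hv, hv', h])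
      exact Fin.ext (by omega))
  obtain ⟨τ, hτ⟩ := exists_perm_extending
    (s := Finset.univ.filter fun i : Fin n => b ≤ 2 * i.val + 1 ∧ 2 * i.val + 1 ≤ b + 2 * ℓ)
    (f := fun i => (U (2 * i + 1)).elim (fun _ => i) id) (by
      intro i hi i' hi' h
      simp only [Finset.coe_filter, Finset.mem_univ, true_and, Set.mem_ofPred_eq] at hi hi'
      obtain ⟨v, hv⟩ := hr _ hi.1 hi.2 (by omega)
      obtain ⟨v', hv'⟩ := hr _ hi'.1 hi'.2 (by omega)
      simp only [hv, hv', Sum.elim_inr, id] at h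
      have := hUinj _ _ hi.1 hi.2 hi'.1 hi'.2 (by rw [hv, hv', h])
      exact Fin.ext (by omega))
  refine ⟨σ, τ, b, ?_⟩
  rw [windowRed_congr (u' := U)]
  · obtain ⟨x, l, rfl⟩ := List.exists_cons_of_length_eq_add_one hlen
    rw [listRedCount_eq_sum x (x :: l)[0], windowRed]
    simp only [List.length_cons, add_left_inj] at hlen
    rw [hlen]
    refine Finset.sum_congr rfl fun i _ => ?_
    simp only [U, Nat.add_sub_cancel_left, add_assoc]
  · intro t h1 h2
    have ht : t / 2 % (ℓ + 1) = t / 2 := Nat.mod_eq_of_lt (by omega)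
    unfold cycleSeq
    simp only [ht]
    split_ifs with hp
    · obtain ⟨v, hv⟩ := hl t h1 h2 hp
      rw [hσ _ (by simp; omega)]
      simp only [show 2 * (t / 2) = t by omega, hv, Sum.elim_inl, id]
    · obtain ⟨v, hv⟩ := hr t h1 h2 hp
      rw [hτ _ (by simp; omega)]
      simp only [show 2 * (t / 2) + 1 = t by omega, hv, Sum.elim_inr, id]

end Cycles

section Balanced

variable {n : ℕ} {c : Fin n → Fin n → Bool}

theorem exists_balanced_of_two : ∀ c : Fin 2 → Fin 2 → Bool, 0 < redTotal c → 0 < blueTotal c →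
    ∃ p q : Equiv.Perm (Fin 2),
      listRedCount c [Sum.inl (p 0), Sum.inr (q 0), Sum.inl (p 1)] = 1 ∨
      listRedCount c [Sum.inr (p 0), Sum.inl (q 0), Sum.inr (p 1)] = 1 := by
  decide +kernel

theorem exists_balanced_of_three : ∀ c : Fin 3 → Fin 3 → Bool, 1 < redTotal c →
    1 < blueTotal c → ∃ p q : Equiv.Perm (Fin 3),
      listRedCount c [Sum.inl (p 0), Sum.inr (q 0), Sum.inl (p 1), Sum.inr (q 1),
        Sum.inl (p 2)] = 2 ∨
      listRedCount c [Sum.inr (p 0), Sum.inl (q 0), Sum.inr (p 1), Sum.inl (q 1),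
        Sum.inr (p 2)] = 2 := by
  decide +kernel

theorem windowRed_not_add_windowRed {u : ℕ → Fin n ⊕ Fin n}
    (halt : ∀ t, (u t).isLeft ≠ (u (t + 1)).isLeft) (ℓ j : ℕ) :
    windowRed (fun v w => !c v w) u ℓ j + windowRed c u ℓ j = 2 * ℓ := by
  simp only [windowRed, redB_not]
  rw [← Finset.sum_add_distrib, Finset.sum_congr rfl fun i _ =>
    (add_comm _ _).trans (redB_toNat_add_blueB_toNat (c := c) (halt (j + i)))]
  simp

theorem redTotal_not (c : Fin n → Fin n → Bool) :
    redTotal (fun v w => !c v w) = blueTotal c := by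
  simp [redTotal, blueTotal]

theorem lt_and_small_or_of_mul_lt {ℓ : ℕ} (hℓ : 1 ≤ ℓ) (hn2 : 2 ≤ n)
    (hn : (ℓ - 1) * (ℓ - (ℓ - 1) / 2) < n) :
    ℓ + 1 ≤ n ∧ (ℓ = 1 ∧ n = 2 ∨ ℓ = 2 ∧ n = 3 ∨ ℓ + 1 < n) := by
  have h : 2 ≤ ℓ → (ℓ - 1) * 2 ≤ (ℓ - 1) * (ℓ - (ℓ - 1) / 2) := fun h => by
    gcongr
    omega
  rcases Nat.lt_or_ge ℓ 2 with h2 | h2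
  · omega
  · have := h h2
    omega

/-- Under the hypotheses of the main theorem there is a window with as many red as blue
edges. -/
theorem exists_balanced_window {ℓ : ℕ} (hℓ : 1 ≤ ℓ) (hℓn : ℓ + 1 ≤ n)
    (hsmall : ℓ = 1 ∧ n = 2 ∨ ℓ = 2 ∧ n = 3 ∨ ℓ + 1 < n)
    (hn : (ℓ - 1) * (ℓ - (ℓ - 1) / 2) < n)
    (hred : (if ℓ % 2 = 0 then (ℓ - 1) / 2 * n + 1 else (ℓ - 1) / 2 * n) < redTotal c)
    (hblue : (if ℓ % 2 = 0 then (ℓ - 1) / 2 * n + 1 else (ℓ - 1) / 2 * n) < blueTotal c) :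
    ∃ σ τ j, windowRed c (cycleSeq ℓ.succ_pos hℓn σ τ) ℓ j = ℓ := by
  have (L : List (Fin n ⊕ Fin n)) (h : listRedCount c L = ℓ) (hL : IsAltPath L)
      (hlen : L.length = 2 * ℓ + 1) :
      ∃ σ τ j, windowRed c (cycleSeq ℓ.succ_pos hℓn σ τ) ℓ j = ℓ :=
    let ⟨σ, τ, j, hj⟩ := exists_windowRed_eq_listRedCount hℓn hL hlen
    ⟨σ, τ, j, hj.trans h⟩
  rcases hsmall with ⟨rfl, rfl⟩ | ⟨rfl, rfl⟩ | hlt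
  · obtain ⟨p, q, h | h⟩ := exists_balanced_of_two c (by simpa using hred) (by simpa using hblue)
    all_goals exact this _ h (by simp [IsAltPath]) rfl
  · obtain ⟨p, q, h | h⟩ := exists_balanced_of_three c (by simpa using hred)
      (by simpa using hblue)
    all_goals exact this _ h (by simp [IsAltPath]) rfl
  · by_contra! hno
    obtain ⟨L, h1, h2, h3⟩ := exists_red_path hℓ hℓn hn hred
    obtain ⟨L', h1', h2', h3'⟩ := exists_red_path hℓ hℓn hn (hblue.trans_eq (redTotal_not c).symm)
    obtain ⟨σ, τ, j, h⟩ := exists_windowRed_eq_listRedCount (c := c) hℓn h1 h2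
    obtain ⟨σ', τ', j', h'⟩ :=
      exists_windowRed_eq_listRedCount (c := fun v w => !c v w) hℓn h1' h2'
    have h4 := windowRed_not_add_windowRed (c := c) (cycleSeq_isLeft_ne ℓ.succ_pos hℓn σ' τ') ℓ j'
    have h5 := (windowRed_lt_iff_of_perm hlt hno σ τ j).trans
      (windowRed_lt_iff_of_perm hlt hno σ' τ' j').symm
    have h6 := hno σ τ j
    have h7 := hno σ' τ' j'
    omega

end Balanced

/-- Bipartite balancing number of paths, upper bound.  Let `k ≥ 2` be even and let
`n ≥ 2` with `n > ((k-2)/2)·(k/2 - ⌊(k-2)/4⌋)`.  With `p(n,k) = ⌊(k-2)/4⌋·n + 1` if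
`k ≡ 0 (mod 4)` and `p(n,k) = ⌊(k-2)/4⌋·n` if `k ≡ 2 (mod 4)`, every 2-edge coloring of
`K_{n,n}` with more than `p(n,k)` edges in each color class contains a balanced copy of
the path `P_k` (with `k/2` edges of each color) and a balanced copy of the path `P_{k+1}`
(with `k/2` edges of one color and `k/2 + 1` of the other). -/
theorem bbal_paths (k n : ℕ) (hk2 : 2 ≤ k) (hkeven : Even k) (hn2 : 2 ≤ n)
    (hn : (k - 2) / 2 * (k / 2 - (k - 2) / 4) < n) :
    ∀ c : Fin n → Fin n → Bool,
      (if k % 4 = 0 then (k - 2) / 4 * n + 1 else (k - 2) / 4 * n) < redTotal c →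
      (if k % 4 = 0 then (k - 2) / 4 * n + 1 else (k - 2) / 4 * n) < blueTotal c →
      (∃ v : Fin (k + 1) → Fin n ⊕ Fin n, IsPathCopy v ∧
        pathRedCount c v = k / 2 ∧ pathBlueCount c v = k / 2) ∧
      (∃ v : Fin (k + 1 + 1) → Fin n ⊕ Fin n, IsPathCopy v ∧
        ((pathRedCount c v = k / 2 ∧ pathBlueCount c v = k / 2 + 1) ∨
         (pathRedCount c v = k / 2 + 1 ∧ pathBlueCount c v = k / 2))) := by
  obtain ⟨ℓ, rfl⟩ := hkeven.two_dvd
  rw [show (2 * ℓ - 2) / 2 = ℓ - 1 by omega, show 2 * ℓ / 2 = ℓ by omega,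
    show (2 * ℓ - 2) / 4 = (ℓ - 1) / 2 by omega] at *
  simp only [show 2 * ℓ % 4 = 0 ↔ ℓ % 2 = 0 by omega]
  intro c hred hblue
  obtain ⟨hℓn, hsmall⟩ := lt_and_small_or_of_mul_lt (by omega) hn2 hn
  obtain ⟨σ, τ, j, h⟩ := exists_balanced_window (by omega) hℓn hsmall hn hred hblue
  exact balanced_paths_of_windowRed_eq (fun _ _ h1 h2 h3 h4 => cycleSeq_injOn _ _ σ τ h1 h2 h3 h4)
    (cycleSeq_isLeft_ne _ _ σ τ) h
end

section
/- Let k ≥ 2 be an even integer, let n ≥ 2 be an integer with n > ((k−2)/2)·(k/2 − ⌊(k−2)/4⌋), and set s = ⌊(k−2)/4⌋ and p(n,k) = s·n + 1 if k ≡ 0 (mod 4), p(n,k) = s·n if k ≡ 2 (mod 4). Then every 2-edge coloring E(K_{n,n}) = R ⊔ B with at least p(n,k) edges in each color class either contains a balanced copy of the path P_k (a path with k edges having exactly k/2 red and k/2 blue edges), or the graph induced by the edges of one of the two colors is isomorphic to K_{s,n} (if k ≡ 2 (mod 4)) or to H_{s,n}, the graph obtained from K_{s,n} by attaching one pendant vertex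 to a vertex of the part of size n (if k ≡ 0 (mod 4)). -/
/-- The number of red edges of the path `g 0, f 0, g 1, f 1, …, f (m - 1), g m`. -/
def zigzag {n : ℕ} (c : Fin n → Fin n → Bool) (m : ℕ) (f g : ℕ → Fin n) : ℕ :=
  ∑ i ∈ Finset.range m, ((c (f i) (g i)).toNat + (c (f i) (g (i + 1))).toNat)

/-- No path with `2 * m` edges that starts in the second part has exactly `m` red edges. -/
def NoBalanced {n : ℕ} (m : ℕ) (c : Fin n → Fin n → Bool) : Prop :=
  ∀ f g : ℕ → Fin n, Set.InjOn f (Set.Iio (m + 1)) → Set.InjOn g (Set.Iio (m + 1)) →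
    zigzag c m f g ≠ m

/-- The number of red edges of the cycle `g 0, f 0, g 1, f 1, …, g m, f m`. -/
def cycleRed {n m : ℕ} (c : Fin n → Fin n → Bool) (f g : Fin (m + 1) → Fin n) : ℕ :=
  ∑ i, ((c (f i) (g i)).toNat + (c (f i) (g (i + 1))).toNat)

theorem sum_range_two_mul (h : ℕ → ℕ) (m : ℕ) :
    ∑ i ∈ Finset.range (m + m), h i = ∑ i ∈ Finset.range m, (h (2 * i) + h (2 * i + 1)) := by
  induction m with
  | zero => simp
  | succ m ih =>
    rw [Finset.sum_range_succ, ← ih, show m + 1 + (m + 1) = m + m + 1 + 1 by ring,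
      Finset.sum_range_succ, Finset.sum_range_succ, show 2 * m = m + m by ring, add_assoc]

theorem redCount_add_blueCount {n ℓ : ℕ} (c : Fin n → Fin n → Bool)
    (v : Fin (ℓ + 1) → Fin n ⊕ Fin n) (hv : IsPathCopy v) :
    pathRedCount c v + pathBlueCount c v = ℓ := by
  unfold pathRedCount pathBlueCount
  have h : ∀ i : Fin ℓ, blueB c (v i.castSucc) (v i.succ) = true ↔
      ¬ redB c (v i.castSucc) (v i.succ) = true := by
    intro i
    have := hv.2 i
    generalize v i.castSucc = x at *
    generalize v i.succ = y at *
    rcases x with x | x <;> rcases y with y | y <;> simp_all [crossB, redB, blueB]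
  simp only [h]
  rw [Finset.card_filter_add_card_filter_not]
  simp

theorem exists_pathCopy_of_zigzag {n m : ℕ} (c : Fin n → Fin n → Bool) (f g : ℕ → Fin n)
    (hf : Set.InjOn f (Set.Iio (m + 1))) (hg : Set.InjOn g (Set.Iio (m + 1))) :
    ∃ v : Fin (m + m + 1) → Fin n ⊕ Fin n, IsPathCopy v ∧ pathRedCount c v = zigzag c m f g := by
  refine ⟨fun i => if i.val % 2 = 0 then Sum.inr (g (i.val / 2)) else Sum.inl (f (i.val / 2)),
    ⟨?_, ?_⟩, ?_⟩
  · intro i j hij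
    have hi := i.isLt
    have hj := j.isLt
    by_cases h1 : i.val % 2 = 0 <;> by_cases h2 : j.val % 2 = 0 <;> simp [h1, h2] at hij
    · have := hg (x₁ := i.val / 2) (x₂ := j.val / 2) (by simp; omega) (by simp; omega) hij
      ext; omega
    · have := hf (x₁ := i.val / 2) (x₂ := j.val / 2) (by simp; omega) (by simp; omega) hij
      ext; omega
  · intro i
    rcases Nat.mod_two_eq_zero_or_one i.val with h | h
    · have : (i.val + 1) % 2 = 1 := by omega
      simp [h, this, crossB]
    · have : (i.val + 1) % 2 = 0 := by omega
      simp [h, this, crossB]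
  · unfold pathRedCount zigzag
    rw [Finset.card_filter]
    have key : ∀ i : Fin (m + m), (if redB c
        (if i.castSucc.val % 2 = 0 then Sum.inr (g (i.castSucc.val / 2))
          else Sum.inl (f (i.castSucc.val / 2)))
        (if i.succ.val % 2 = 0 then Sum.inr (g (i.succ.val / 2))
          else Sum.inl (f (i.succ.val / 2))) = true then 1 else 0) =
        (fun i : ℕ => (c (f (i / 2)) (g ((i + 1) / 2))).toNat) i.val := by
      intro i
      rcases Nat.mod_two_eq_zero_or_one i.val with h | h
      · have h1 : (i.val + 1) % 2 = 1 := by omega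
        have h2 : (i.val + 1) / 2 = i.val / 2 := by omega
        simp only [Fin.val_castSucc, Fin.val_succ, h, h1, h2, redB]
        cases h3 : c (f (i.val / 2)) (g (i.val / 2)) <;> simp [h3]
      · have h1 : (i.val + 1) % 2 = 0 := by omega
        simp only [Fin.val_castSucc, Fin.val_succ, h, h1, redB]
        cases h3 : c (f (i.val / 2)) (g ((i.val + 1) / 2)) <;> simp [h3]
    rw [Finset.sum_congr rfl (fun i _ => key i),
      Fin.sum_univ_eq_sum_range (fun i : ℕ => (c (f (i / 2)) (g ((i + 1) / 2))).toNat),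
      sum_range_two_mul]
    refine Finset.sum_congr rfl fun i _ => ?_
    rw [show 2 * i / 2 = i by omega, show (2 * i + 1) / 2 = i by omega,
      show (2 * i + 1 + 1) / 2 = i + 1 by omega]

theorem exists_balanced_of_swap {n ℓ r : ℕ} (c : Fin n → Fin n → Bool)
    (v : Fin (ℓ + 1) → Fin n ⊕ Fin n) (hv : IsPathCopy v)
    (hr : pathRedCount (fun a b => c b a) v = r) :
    ∃ v' : Fin (ℓ + 1) → Fin n ⊕ Fin n, IsPathCopy v' ∧ pathRedCount c v' = r := by
  refine ⟨fun i => (v i).swap, ⟨?_, ?_⟩, ?_⟩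
  · exact Sum.swap_leftInverse.injective.comp hv.1
  · intro i
    have := hv.2 i
    rcases h : v i.castSucc with x | x <;> rcases h' : v i.succ with y | y <;>
      simp_all [crossB]
  · rw [← hr]
    unfold pathRedCount
    congr 1
    refine Finset.filter_congr fun i _ => ?_
    rcases h : v i.castSucc with x | x <;> rcases h' : v i.succ with y | y <;>
      simp_all [redB]

theorem noBalanced_of_not_exists {n m : ℕ} (c : Fin n → Fin n → Bool)
    (h : ¬ ∃ v : Fin (m + m + 1) → Fin n ⊕ Fin n, IsPathCopy v ∧
      pathRedCount c v = m ∧ pathBlueCount c v = m) :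
    NoBalanced m c ∧ NoBalanced m (fun a b => c b a) := by
  have h' : ∀ v : Fin (m + m + 1) → Fin n ⊕ Fin n, IsPathCopy v → pathRedCount c v ≠ m := by
    intro v hv hr
    have := redCount_add_blueCount c v hv
    exact h ⟨v, hv, hr, by omega⟩
  constructor
  · intro f g hf hg hz
    obtain ⟨v, hv, hr⟩ := exists_pathCopy_of_zigzag c f g hf hg
    exact h' v hv (hr.trans hz)
  · intro f g hf hg hz
    obtain ⟨v, hv, hr⟩ := exists_pathCopy_of_zigzag (fun a b => c b a) f g hf hg
    obtain ⟨v', hv', hr'⟩ := exists_balanced_of_swap c v hv (hr.trans hz)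
    exact h' v' hv' hr'

theorem NoBalanced.compl {n m : ℕ} {c : Fin n → Fin n → Bool} (h : NoBalanced m c) :
    NoBalanced m (fun a b => !c a b) := by
  intro f g hf hg hz
  apply h f g hf hg
  have : zigzag (fun a b => !c a b) m f g + zigzag c m f g = ∑ i ∈ Finset.range m, 2 := by
    unfold zigzag
    rw [← Finset.sum_add_distrib]
    refine Finset.sum_congr rfl fun i _ => ?_
    cases h1 : c (f i) (g i) <;> cases h2 : c (f i) (g (i + 1)) <;> simp [h1, h2]
  simp at this
  omega

theorem cycleRed_compl {n m : ℕ} (c : Fin n → Fin n → Bool) (f g : Fin (m + 1) → Fin n) :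
    cycleRed (fun a b => !c a b) f g + cycleRed c f g = 2 * m + 2 := by
  have : cycleRed (fun a b => !c a b) f g + cycleRed c f g = ∑ i : Fin (m + 1), 2 := by
    unfold cycleRed
    rw [← Finset.sum_add_distrib]
    refine Finset.sum_congr rfl fun i _ => ?_
    cases h1 : c (f i) (g i) <;> cases h2 : c (f i) (g (i + 1)) <;> simp [h1, h2]
  simp at this
  omega

theorem injOn_ofNat {n m : ℕ} {f : Fin (m + 1) → Fin n} (hf : Function.Injective f)
    (t : Fin (m + 1)) :
    Set.InjOn (fun i : ℕ => f (t + Fin.ofNat (m + 1) i)) (Set.Iio (m + 1)) := by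
  intro i hi j hj hij
  have := add_left_cancel (hf hij)
  simp only [Set.mem_Iio] at hi hj
  simpa [Fin.ofNat, Fin.ext_iff, Nat.mod_eq_of_lt hi, Nat.mod_eq_of_lt hj] using this

theorem zigzag_window {n m : ℕ} (c : Fin n → Fin n → Bool) (f g : Fin (m + 1) → Fin n)
    (t : Fin (m + 1)) :
    zigzag c m (fun i => f (t + Fin.ofNat (m + 1) i)) (fun i => g (t + Fin.ofNat (m + 1) i)) +
      ((c (f (t + Fin.last m)) (g (t + Fin.last m))).toNat +
        (c (f (t + Fin.last m)) (g (t + Fin.last m + 1))).toNat) = cycleRed c f g := by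
  set φ : Fin (m + 1) → ℕ := fun i => (c (f i) (g i)).toNat + (c (f i) (g (i + 1))).toNat with hφ
  have h1 : cycleRed c f g = ∑ i, φ (t + i) := by
    exact (Equiv.sum_comp (Equiv.addLeft t) φ).symm
  have h2 : ∀ i : Fin (m + 1), φ (t + i) = (fun i : ℕ => φ (t + Fin.ofNat (m + 1) i)) i.val := by
    intro i
    simp
  rw [h1, Finset.sum_congr rfl (fun i _ => h2 i),
    Fin.sum_univ_eq_sum_range (fun i : ℕ => φ (t + Fin.ofNat (m + 1) i)),
    Finset.sum_range_succ]
  congr 1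
  · refine Finset.sum_congr rfl fun i _ => ?_
    have : Fin.ofNat (m + 1) (i + 1) = Fin.ofNat (m + 1) i + 1 := by
      ext; simp [Fin.val_add]
    simp only [hφ, this, add_assoc]
  · have : Fin.ofNat (m + 1) m = Fin.last m := by ext; simp
    rw [this]

theorem NoBalanced.cycleRed_ne {n m : ℕ} {c : Fin n → Fin n → Bool} (h : NoBalanced m c)
    {f g : Fin (m + 1) → Fin n} (hf : Function.Injective f) (hg : Function.Injective g)
    (j : Fin (m + 1)) :
    m + ((c (f j) (g j)).toNat + (c (f j) (g (j + 1))).toNat) ≠ cycleRed c f g := by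
  have h1 := zigzag_window c f g (j - Fin.last m)
  rw [sub_add_cancel] at h1
  have h2 := h _ _ (injOn_ofNat hf (j - Fin.last m)) (injOn_ofNat hg (j - Fin.last m))
  omega

theorem cycleRed_swap {n m : ℕ} (c : Fin n → Fin n → Bool) (f g : Fin (m + 1) → Fin n) :
    cycleRed (fun a b => c b a) (fun i => g (i + 1)) f = cycleRed c f g := by
  unfold cycleRed
  rw [Finset.sum_add_distrib, Finset.sum_add_distrib, add_comm]
  congr 1
  exact Equiv.sum_comp (Equiv.addRight 1) fun i => (c (f i) (g i)).toNat

theorem NoBalanced.cycleRed_ne_swap {n m : ℕ} {c : Fin n → Fin n → Bool}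
    (h : NoBalanced m (fun a b => c b a))
    {f g : Fin (m + 1) → Fin n} (hf : Function.Injective f) (hg : Function.Injective g)
    (j : Fin (m + 1)) :
    m + ((c (f j) (g (j + 1))).toNat + (c (f (j + 1)) (g (j + 1))).toNat) ≠ cycleRed c f g := by
  rw [← cycleRed_swap]
  exact h.cycleRed_ne (hg.comp (add_left_injective 1)) hf j

theorem NoBalanced.cycleRed_ne_succ {n m : ℕ} {c : Fin n → Fin n → Bool}
    (h : NoBalanced m c) (h' : NoBalanced m (fun a b => c b a))
    {f g : Fin (m + 1) → Fin n} (hf : Function.Injective f) (hg : Function.Injective g) :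
    cycleRed c f g ≠ m + 1 := by
  intro hT
  have h1 : ∀ j, c (f j) (g j) = c (f j) (g (j + 1)) := by
    intro j
    have := h.cycleRed_ne hf hg j
    cases hx : c (f j) (g j) <;> cases hy : c (f j) (g (j + 1)) <;> simp_all
  have h2 : ∀ j, c (f j) (g (j + 1)) = c (f (j + 1)) (g (j + 1)) := by
    intro j
    have := NoBalanced.cycleRed_ne_swap h' hf hg j
    cases hx : c (f j) (g (j + 1)) <;> cases hy : c (f (j + 1)) (g (j + 1)) <;> simp_all
  have h3 : ∀ j, c (f j) (g j) = c (f 0) (g 0) := by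
    intro j
    induction j using Fin.induction with
    | zero => rfl
    | succ i ih => rw [← Fin.coeSucc_eq_succ, ← h2, ← h1, ih]
  have h4 : cycleRed c f g = ∑ i : Fin (m + 1), 2 * (c (f 0) (g 0)).toNat := by
    unfold cycleRed
    refine Finset.sum_congr rfl fun i _ => ?_
    rw [← h1, h3]
    ring
  rw [h4] at hT
  cases hx : c (f 0) (g 0) <;> simp [hx] at hT

theorem NoBalanced.cycleRed_le_of_agree {n m : ℕ} {c : Fin n → Fin n → Bool}
    (h : NoBalanced m c) (h' : NoBalanced m (fun a b => c b a))
    {f f' g : Fin (m + 1) → Fin n} (hf : Function.Injective f) (hf' : Function.Injective f')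
    (hg : Function.Injective g) (j : Fin (m + 1)) (hff' : ∀ i, i ≠ j → f i = f' i)
    (hle : cycleRed c f g ≤ m) : cycleRed c f' g ≤ m := by
  have h1 := h.cycleRed_ne hf hg j
  have h3 := h.cycleRed_ne_succ h' hf' hg
  have e1 : cycleRed c f g = ((c (f j) (g j)).toNat + (c (f j) (g (j + 1))).toNat) +
      ∑ i ∈ Finset.univ.erase j, ((c (f i) (g i)).toNat + (c (f i) (g (i + 1))).toNat) :=
    (Finset.add_sum_erase _ _ (Finset.mem_univ j)).symm
  have e2 : cycleRed c f' g = ((c (f' j) (g j)).toNat + (c (f' j) (g (j + 1))).toNat) +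
      ∑ i ∈ Finset.univ.erase j, ((c (f' i) (g i)).toNat + (c (f' i) (g (i + 1))).toNat) :=
    (Finset.add_sum_erase _ _ (Finset.mem_univ j)).symm
  have e3 : ∑ i ∈ Finset.univ.erase j, ((c (f i) (g i)).toNat + (c (f i) (g (i + 1))).toNat) =
      ∑ i ∈ Finset.univ.erase j, ((c (f' i) (g i)).toNat + (c (f' i) (g (i + 1))).toNat) := by
    refine Finset.sum_congr rfl fun i hi => ?_
    rw [hff' i (Finset.ne_of_mem_erase hi)]
  have b1 := Bool.toNat_le (c (f' j) (g j))
  have b2 := Bool.toNat_le (c (f' j) (g (j + 1)))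
  omega

/-- A property of injections into a type with a spare element that is preserved under changing a
single value holds for all injections once it holds for one. -/
theorem injective_induction {ι α : Type*} [Fintype ι] [DecidableEq ι] [Fintype α]
    [DecidableEq α] (hcard : Fintype.card ι < Fintype.card α) (Q : (ι → α) → Prop)
    (hQ : ∀ f f' : ι → α, Function.Injective f → Function.Injective f' →
      ∀ j, (∀ i, i ≠ j → f i = f' i) → Q f → Q f')
    (f f' : ι → α) (hf : Function.Injective f) (hf' : Function.Injective f') (h : Q f) : Q f' := by
  have upd : ∀ (f : ι → α) (j : ι) (z : α), Function.Injective f → (∀ i, f i ≠ z) →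
      Function.Injective (Function.update f j z) := by
    intro f j z hf hz a b hab
    by_cases ha : a = j <;> by_cases hb : b = j
    · rw [ha, hb]
    · subst ha
      simp only [Function.update_self, Function.update_of_ne hb] at hab
      exact absurd hab.symm (hz b)
    · subst hb
      simp only [Function.update_self, Function.update_of_ne ha] at hab
      exact absurd hab (hz a)
    · simp only [Function.update_of_ne ha, Function.update_of_ne hb] at hab
      exact hf hab
  have Qupd : ∀ (f : ι → α) (j : ι) (z : α), Function.Injective f → (∀ i, f i ≠ z) → Q f →
      Q (Function.update f j z) := fun f j z hf hz h =>
    hQ f _ hf (upd f j z hf hz) j (fun i hi => (Function.update_of_ne hi _ _).symm) h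
  induction hN : (Finset.univ.filter fun i => f i ≠ f' i).card using Nat.strong_induction_on
    generalizing f with
  | _ N ih =>
  by_cases heq : f = f'
  · exact heq ▸ h
  obtain ⟨i, hi⟩ := Function.ne_iff.1 heq
  have step : ∀ e : ι → α, Function.Injective e → Q e → (∀ k, e k ≠ f' i) →
      (∀ k, f k = f' k → e k = f' k) → Q f' := by
    intro e he hQe hfree hagree
    refine ih _ ?_ (Function.update e i (f' i)) (upd e i _ he hfree) (Qupd e i _ he hfree hQe) rfl
    rw [← hN]
    apply Finset.card_lt_card
    rw [Finset.ssubset_iff_of_subset]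
    · exact ⟨i, by simp [hi], by simp⟩
    · intro k hk
      simp only [Finset.mem_filter, Finset.mem_univ, true_and] at hk ⊢
      intro hfk
      apply hk
      by_cases hki : k = i
      · subst hki; simp
      · rw [Function.update_of_ne hki, hagree k hfk]
  by_cases hex : ∃ j, f j = f' i
  · obtain ⟨j, hj⟩ := hex
    obtain ⟨z, hz⟩ : ∃ z, z ∉ Finset.univ.image f := by
      by_contra! hall
      have h1 : (Finset.univ.image f).card = Fintype.card α := by
        rw [Finset.eq_univ_of_forall hall, Finset.card_univ]
      have h2 : (Finset.univ.image f).card ≤ Fintype.card ι := Finset.card_image_le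
      omega
    have hz' : ∀ k, f k ≠ z := fun k hk => hz (by simp [← hk])
    refine step (Function.update f j z) (upd f j z hf hz') (Qupd f j z hf hz' h) ?_ ?_
    · intro k
      by_cases hk : k = j
      · subst hk
        simp only [Function.update_self]
        rintro rfl
        exact hz' _ hj
      · rw [Function.update_of_ne hk]
        intro hk'
        exact hk (hf (hk'.trans hj.symm))
    · intro k hk
      have : k ≠ j := by
        rintro rfl
        have := hf' (hk.symm.trans hj)
        subst this
        exact hi hj
      rw [Function.update_of_ne this, hk]
  · push Not at hex
    exact step f hf h hex fun _ => id

theorem NoBalanced.cycleRed_le_all {n m : ℕ} {c : Fin n → Fin n → Bool}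
    (hn : m + 2 ≤ n) (h : NoBalanced m c) (h' : NoBalanced m (fun a b => c b a))
    {f g : Fin (m + 1) → Fin n} (hf : Function.Injective f) (hg : Function.Injective g)
    (hle : cycleRed c f g ≤ m)
    {f' g' : Fin (m + 1) → Fin n} (hf' : Function.Injective f') (hg' : Function.Injective g') :
    cycleRed c f' g' ≤ m := by
  have hcard : Fintype.card (Fin (m + 1)) < Fintype.card (Fin n) := by simp; omega
  have step1 : cycleRed c f' g ≤ m :=
    injective_induction hcard (fun e => cycleRed c e g ≤ m)
      (fun e e' he he' j hj hQ => h.cycleRed_le_of_agree h' he he' hg j hj hQ) f f' hf hf' hle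
  refine injective_induction hcard (fun e => cycleRed c f' e ≤ m)
      (fun e e' he he' j hj hQ => ?_) g g' hg hg' step1
  rw [← cycleRed_swap] at hQ ⊢
  refine NoBalanced.cycleRed_le_of_agree h' h (he.comp (add_left_injective 1))
    (he'.comp (add_left_injective 1)) hf' (j - 1) (fun i hi => hj _ ?_) hQ
  rintro rfl
  exact hi (by simp)

/-- Whether `a` is joined in red to the second entry of the head of `L`, as a number. -/
def headRed {n : ℕ} (c : Fin n → Fin n → Bool) (a : Fin n) : List (Fin n × Fin n) → ℕ
  | [] => 0
  | q :: _ => (c a q.2).toNat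

/-- The number of red edges of the path `b₀, a₀, b₁, a₁, …` given by a list of pairs `(aᵢ, bᵢ)`. -/
def listRed {n : ℕ} (c : Fin n → Fin n → Bool) : List (Fin n × Fin n) → ℕ
  | [] => 0
  | p :: L => (c p.1 p.2).toNat + headRed c p.1 L + listRed c L

theorem listRed_le_zigzag {n : ℕ} (c : Fin n → Fin n → Bool) (L : List (Fin n × Fin n))
    (f g : ℕ → Fin n) (hfg : ∀ i (hi : i < L.length), L[i] = (f i, g i)) :
    listRed c L ≤ zigzag c L.length f g := by
  induction L generalizing f g with
  | nil => simp [listRed]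
  | cons p L ih =>
    have h0 := hfg 0 (by simp)
    have h1 := ih (fun i => f (i + 1)) (fun i => g (i + 1)) fun i hi => by
      have := hfg (i + 1) (by simpa using hi)
      simpa using this
    simp only [List.getElem_cons_zero] at h0
    have h2 : zigzag c (p :: L).length f g =
        zigzag c L.length (fun i => f (i + 1)) (fun i => g (i + 1)) +
          ((c (f 0) (g 0)).toNat + (c (f 0) (g 1)).toNat) := by
      simp only [zigzag, List.length_cons]
      rw [Finset.sum_range_succ']
    have h3 : headRed c p.1 L ≤ (c (f 0) (g 1)).toNat := by
      cases L with
      | nil => simp [headRed]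
      | cons q L' =>
        have := hfg 1 (by simp)
        simp only [List.getElem_cons_succ, List.getElem_cons_zero] at this
        simp [headRed, this, h0]
    rw [h2]
    simp only [listRed]
    rw [h0] at h3 ⊢
    simp only at h3 ⊢
    omega

theorem exists_injective_extend {n m : ℕ} (hn : m < n) (l : List (Fin n)) (hl : l.Nodup)
    (hlen : l.length = m) :
    ∃ f : Fin (m + 1) → Fin n, Function.Injective f ∧
      ∀ i (hi : i < l.length), f (Fin.ofNat (m + 1) i) = l[i] := by
  obtain ⟨x, hx⟩ : ∃ x, x ∉ l.toFinset := by
    by_contra! hall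
    have h1 : l.toFinset.card = n := by
      rw [Finset.eq_univ_of_forall hall, Finset.card_univ, Fintype.card_fin]
    have h2 := l.toFinset_card_le
    omega
  have hnd : (x :: l).Nodup := List.nodup_cons.2 ⟨by simpa using hx, hl⟩
  have hnd' : (l ++ [x]).Nodup := by
    rw [List.nodup_append_comm]; simpa using hnd
  subst hlen
  refine ⟨fun i => (l ++ [x])[i.val]'(by simp; omega), ?_, ?_⟩
  · intro i j hij
    have := (List.Nodup.getElem_inj_iff hnd').1 hij
    exact Fin.ext this
  · intro i hi
    have : i % (l.length + 1) = i := Nat.mod_eq_of_lt (by omega)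
    simp [Fin.ofNat, this, hi]

theorem NoBalanced.listRed_lt {n m : ℕ} {c : Fin n → Fin n → Bool} (hn : m < n)
    (h : NoBalanced m c)
    (hlow : ∀ f g : Fin (m + 1) → Fin n, Function.Injective f → Function.Injective g →
      cycleRed c f g ≤ m)
    (L : List (Fin n × Fin n)) (h1 : (L.map Prod.fst).Nodup) (h2 : (L.map Prod.snd).Nodup)
    (hlen : L.length = m) : listRed c L < m := by
  obtain ⟨f, hf, hfL⟩ := exists_injective_extend hn _ h1 (by simpa using hlen)
  obtain ⟨g, hg, hgL⟩ := exists_injective_extend hn _ h2 (by simpa using hlen)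
  have e1 := zigzag_window c f g 0
  have e2 := hlow f g hf hg
  have e3 := h _ _ (injOn_ofNat hf 0) (injOn_ofNat hg 0)
  have e4 := listRed_le_zigzag c L (fun i => f (0 + Fin.ofNat (m + 1) i))
    (fun i => g (0 + Fin.ofNat (m + 1) i)) fun i hi => by
      rw [zero_add, hfL i (by simpa using hi), hgL i (by simpa using hi)]
      simp
  rw [hlen] at e4
  omega

theorem listRed_le_cons {n : ℕ} (c : Fin n → Fin n → Bool) (p : Fin n × Fin n)
    (L : List (Fin n × Fin n)) : (c p.1 p.2).toNat + listRed c L ≤ listRed c (p :: L) := by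
  simp only [listRed]
  omega

theorem exists_two_notMem {α : Type*} [DecidableEq α] (S T : Finset α)
    (h : T.card + 2 ≤ S.card) : ∃ x ∈ S, ∃ y ∈ S, x ∉ T ∧ y ∉ T ∧ x ≠ y := by
  have h1 : 1 < (S \ T).card := by
    have := Finset.le_card_sdiff T S
    omega
  obtain ⟨x, hx, y, hy, hxy⟩ := Finset.one_lt_card.1 h1
  simp only [Finset.mem_sdiff] at hx hy
  exact ⟨x, hx.1, y, hy.1, hx.2, hy.2, hxy⟩

theorem exists_notMem {n : ℕ} (T : Finset (Fin n)) (h : T.card < n) : ∃ x, x ∉ T := by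
  by_contra! hall
  rw [Finset.eq_univ_of_forall hall] at h
  simp at h

/-- A list of pairs whose zigzag path has at least as many red edges as the list has entries. -/
structure RedList {n : ℕ} (c : Fin n → Fin n → Bool) (L : List (Fin n × Fin n)) : Prop where
  nodup_fst : (L.map Prod.fst).Nodup
  nodup_snd : (L.map Prod.snd).Nodup
  length_le : L.length ≤ listRed c L

/-- Vertices of large red degree can be used as centers of red cherries to prolong a list. -/
theorem RedList.exists_extend {n m : ℕ} {c : Fin n → Fin n → Bool} (hn : m ≤ n) (N : ℕ) :
    ∀ (HA HB : Finset (Fin n)) (L : List (Fin n × Fin n)), HA.card + HB.card = N →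
      (∀ a ∈ HA, m ≤ (Finset.univ.filter fun b => c a b = true).card) →
      (∀ b ∈ HB, m ≤ (Finset.univ.filter fun a => c a b = true).card) →
      RedList c L → (∀ a ∈ HA, a ∉ L.map Prod.fst) → (∀ b ∈ HB, b ∉ L.map Prod.snd) →
      L.length + 2 * N ≤ m → ∃ L', RedList c L' ∧ L'.length = L.length + 2 * N := by
  induction N with
  | zero =>
    intro HA HB L _ _ _ hL _ _ _
    exact ⟨L, hL, rfl⟩
  | succ N ih =>
    intro HA HB L hcard hdA hdB hL hA hB hm
    have lenA := (L.map Prod.fst).toFinset_card_le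
    have lenB := (L.map Prod.snd).toFinset_card_le
    have unA := Finset.card_union_le (L.map Prod.fst).toFinset HA
    have unB := Finset.card_union_le (L.map Prod.snd).toFinset HB
    rw [List.length_map] at lenA lenB
    rcases HA.eq_empty_or_nonempty with hHA | ⟨u, hu⟩
    · subst hHA
      simp only [Finset.card_empty, zero_add] at hcard
      obtain ⟨u, hu⟩ : HB.Nonempty := Finset.card_pos.1 (by omega)
      have hpos : 0 < HB.card := Finset.card_pos.2 ⟨u, hu⟩
      obtain ⟨a, ha, a', ha', haL, haL', hne⟩ := exists_two_notMem _
        ((L.map Prod.fst).toFinset) (by have := hdB u hu; omega :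
          _ ≤ (Finset.univ.filter fun a => c a u = true).card)
      obtain ⟨y, hy⟩ := exists_notMem ((L.map Prod.snd).toFinset ∪ HB) (by omega)
      simp only [Finset.mem_filter, Finset.mem_univ, true_and] at ha ha'
      simp only [Finset.mem_union, List.mem_toFinset, not_or] at haL haL' hy
      have huy : u ≠ y := fun h => hy.2 (h ▸ hu)
      have hlen : ((a, y) :: (a', u) :: L).length = L.length + 2 := rfl
      have hgood : RedList c ((a, y) :: (a', u) :: L) := by
        refine ⟨by simpa [-List.mem_map, hne] using ⟨haL, haL', hL.nodup_fst⟩,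
          by simpa [-List.mem_map, huy.symm] using ⟨hy.1, hB u hu, hL.nodup_snd⟩, ?_⟩
        have h1 := listRed_le_cons c (a', u) L
        have h2 := hL.length_le
        simp only [ha', Bool.toNat_true] at h1
        rw [hlen, listRed]
        simp only [headRed, ha, Bool.toNat_true]
        omega
      obtain ⟨L', hL', hlen'⟩ := ih ∅ (HB.erase u) ((a, y) :: (a', u) :: L)
        (by rw [Finset.card_erase_of_mem hu]; simp; omega) (by simp)
        (fun b hb => hdB b (Finset.mem_of_mem_erase hb)) hgood (by simp)
        (fun b hb => by
          have hbB := Finset.mem_of_mem_erase hb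
          have h1 := Finset.ne_of_mem_erase hb
          have h2 : b ≠ y := fun h => hy.2 (h ▸ hbB)
          simpa [-List.mem_map, h1, h2] using hB b hbB) (by omega)
      exact ⟨L', hL', by omega⟩
    · have hpos : 0 < HA.card := Finset.card_pos.2 ⟨u, hu⟩
      obtain ⟨b, hb, b', hb', hbL, hbL', hne⟩ := exists_two_notMem _
        ((L.map Prod.snd).toFinset ∪ HB) (by have := hdA u hu; omega :
          _ ≤ (Finset.univ.filter fun b => c u b = true).card)
      obtain ⟨x, hx⟩ := exists_notMem ((L.map Prod.fst).toFinset ∪ HA) (by omega)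
      simp only [Finset.mem_filter, Finset.mem_univ, true_and] at hb hb'
      simp only [Finset.mem_union, List.mem_toFinset, not_or] at hbL hbL' hx
      have hux : u ≠ x := fun h => hx.2 (h ▸ hu)
      have hlen : ((u, b) :: (x, b') :: L).length = L.length + 2 := rfl
      have hgood : RedList c ((u, b) :: (x, b') :: L) := by
        refine ⟨by simpa [-List.mem_map, hux] using ⟨hA u hu, hx.1, hL.nodup_fst⟩,
          by simpa [-List.mem_map, hne] using ⟨hbL.1, hbL'.1, hL.nodup_snd⟩, ?_⟩
        have h1 := listRed_le_cons c (x, b') L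
        have h2 := hL.length_le
        rw [hlen, listRed]
        simp only [headRed, hb, hb', Bool.toNat_true]
        omega
      obtain ⟨L', hL', hlen'⟩ := ih (HA.erase u) HB ((u, b) :: (x, b') :: L)
        (by rw [Finset.card_erase_of_mem hu]; omega)
        (fun a ha => hdA a (Finset.mem_of_mem_erase ha)) hdB hgood
        (fun a ha => by
          have haA := Finset.mem_of_mem_erase ha
          have h1 := Finset.ne_of_mem_erase ha
          have h2 : a ≠ x := fun h => hx.2 (h ▸ haA)
          simpa [-List.mem_map, h1, h2] using hA a haA)
        (fun d hd => by
          have h1 : d ≠ b := fun h => hbL.2 (h ▸ hd)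
          have h2 : d ≠ b' := fun h => hbL'.2 (h ▸ hd)
          simpa [-List.mem_map, h1, h2] using hB d hd) (by omega)
      exact ⟨L', hL', by omega⟩

theorem length_le_listRed {n : ℕ} (c : Fin n → Fin n → Bool) (L : List (Fin n × Fin n))
    (h : ∀ p ∈ L, c p.1 p.2 = true) : L.length ≤ listRed c L := by
  induction L with
  | nil => simp
  | cons p L ih =>
    have h1 := listRed_le_cons c p L
    have h2 := ih fun q hq => h q (List.mem_cons_of_mem _ hq)
    rw [h p List.mem_cons_self] at h1
    simp at h1 ⊢
    omega

/-- If no matching of size `m` exists, the red edges have a vertex cover of size less than `m`. -/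
theorem exists_cover {n m : ℕ} {c : Fin n → Fin n → Bool} (hn : m ≤ n)
    (hno : ∀ L, RedList c L → L.length ≠ m) :
    ∃ CA CB : Finset (Fin n), CA.card + CB.card < m ∧
      ∀ a b, c a b = true → a ∈ CA ∨ b ∈ CB := by
  classical
  by_contra! hcov
  let N : Fin n → Finset (Fin n) := fun a => Finset.univ.filter fun b => c a b = true
  let t : Fin n → Finset (Fin n ⊕ Fin (n - m)) := fun a => (N a).disjSum Finset.univ
  have hall : ∀ S : Finset (Fin n), S.card ≤ (S.biUnion t).card := by
    intro S
    rcases S.eq_empty_or_nonempty with rfl | ⟨a, ha⟩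
    · simp
    have h1 : (S.biUnion N).disjSum Finset.univ ⊆ S.biUnion t := by
      intro x hx
      rcases x with x | x
      · simp only [Finset.inl_mem_disjSum, Finset.mem_biUnion] at hx
        simpa [t] using hx
      · simp only [Finset.mem_biUnion]
        exact ⟨a, ha, by simp [t]⟩
    have h2 := Finset.card_le_card h1
    rw [Finset.card_disjSum, Finset.card_univ, Fintype.card_fin] at h2
    have h3 : m ≤ Sᶜ.card + (S.biUnion N).card := by
      by_contra! hlt
      obtain ⟨x, y, hxy, hx, hy⟩ := hcov Sᶜ (S.biUnion N) hlt
      simp only [Finset.mem_compl, not_not] at hx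
      exact hy (Finset.mem_biUnion.2 ⟨x, hx, by simp [N, hxy]⟩)
    rw [Finset.card_compl, Fintype.card_fin] at h3
    have h4 : S.card ≤ n := by simpa using S.card_le_univ
    omega
  obtain ⟨φ, hφ, hφt⟩ := (Finset.all_card_le_biUnion_card_iff_exists_injective t).1 hall
  let A := Finset.univ.filter fun a => (φ a).isLeft = true
  have hA : m ≤ A.card := by
    have h1 : (Finset.univ.filter fun a => ¬ (φ a).isLeft = true).card ≤ n - m := by
      have := Finset.card_le_card_of_injOn (s := Finset.univ.filter fun a => ¬ (φ a).isLeft = true)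
        (t := (Finset.univ : Finset (Fin (n - m))).map ⟨Sum.inr, Sum.inr_injective⟩) φ
        (by
          intro a ha
          simp only [Finset.coe_filter, Finset.mem_univ, true_and, Set.mem_ofPred_eq] at ha
          rcases h : φ a with x | x
          · simp [h] at ha
          · simp)
        hφ.injOn
      simpa using this
    have h2 := Finset.card_filter_add_card_filter_not (s := (Finset.univ : Finset (Fin n)))
      (fun a => (φ a).isLeft = true)
    simp only [Finset.card_univ, Fintype.card_fin] at h2
    change _ ≤ (Finset.univ.filter fun a => (φ a).isLeft = true).card
    omega
  have hψ : ∀ a : A, ∃ b, φ a = Sum.inl b := by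
    rintro ⟨a, ha⟩
    simp only [A, Finset.mem_filter, Finset.mem_univ, true_and] at ha
    exact Sum.isLeft_iff.1 ha
  choose ψ hψ using hψ
  have hψc : ∀ a : A, c a (ψ a) = true := by
    intro a
    have := hφt a
    rw [hψ a] at this
    simpa [t, N] using this
  have hψi : Function.Injective ψ := by
    intro a b hab
    apply Subtype.ext
    apply hφ
    rw [hψ a, hψ b, hab]
  let l := (A.attach.toList.take m)
  have hl : l.Nodup := (Finset.nodup_toList _).sublist (List.take_sublist _ _)
  refine hno (l.map fun a : A => ((a : Fin n), ψ a)) ⟨?_, ?_, ?_⟩ ?_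
  · rw [List.map_map]
    exact hl.map Subtype.val_injective
  · rw [List.map_map]
    exact hl.map hψi
  · apply length_le_listRed
    intro p hp
    obtain ⟨a, _, rfl⟩ := List.mem_map.1 hp
    exact hψc a
  · simp [l, hA]

theorem sum_le_of_subset {α : Type*} [DecidableEq α] {H C : Finset α} (hHC : H ⊆ C) (d : α → ℕ)
    {n r : ℕ} (hn : ∀ a, d a ≤ n) (hr : ∀ a, a ∉ H → d a ≤ r) :
    ∑ a ∈ C, d a ≤ (C \ H).card * r + H.card * n := by
  rw [← Finset.sum_sdiff hHC]
  exact Nat.add_le_add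
    (Finset.sum_le_card_nsmul _ _ _ fun a ha => hr a (Finset.mem_sdiff.1 ha).2)
    (Finset.sum_le_card_nsmul _ _ _ fun a _ => hn a)

theorem redTotal_le_of_cover {n : ℕ} {c : Fin n → Fin n → Bool} {CA CB : Finset (Fin n)}
    (hcov : ∀ a b, c a b = true → a ∈ CA ∨ b ∈ CB) :
    redTotal c ≤ ∑ a ∈ CA, (Finset.univ.filter fun b => c a b = true).card +
      ∑ b ∈ CB, (Finset.univ.filter fun a => c a b = true).card := by
  have hsub : (Finset.univ.filter fun p : Fin n × Fin n => c p.1 p.2 = true) ⊆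
      (CA.biUnion fun a => (Finset.univ.filter fun b => c a b = true).image fun b => (a, b)) ∪
      (CB.biUnion fun b => (Finset.univ.filter fun a => c a b = true).image fun a => (a, b)) := by
    rintro ⟨a, b⟩ hp
    simp only [Finset.mem_filter, Finset.mem_univ, true_and] at hp
    simp only [Finset.mem_union, Finset.mem_biUnion, Finset.mem_image, Finset.mem_filter,
      Finset.mem_univ, true_and, Prod.mk.injEq]
    rcases hcov a b hp with h | h
    · exact Or.inl ⟨a, h, b, hp, rfl, rfl⟩
    · exact Or.inr ⟨b, h, a, hp, rfl, rfl⟩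
  refine (Finset.card_le_card hsub).trans ((Finset.card_union_le _ _).trans ?_)
  exact Nat.add_le_add
    (Finset.card_biUnion_le.trans (Finset.sum_le_sum fun _ _ => Finset.card_image_le))
    (Finset.card_biUnion_le.trans (Finset.sum_le_sum fun _ _ => Finset.card_image_le))

/-- There are `s` full vertices, all in the same part, and exactly `ε` further red edges. -/
def RedStructure {n : ℕ} (c : Fin n → Fin n → Bool) (s ε : ℕ) : Prop :=
  ∃ HA HB : Finset (Fin n), HA.card + HB.card = s ∧ (HA = ∅ ∨ HB = ∅) ∧
    (∀ a b, a ∈ HA ∨ b ∈ HB → c a b = true) ∧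
    (Finset.univ.filter fun p : Fin n × Fin n =>
      c p.1 p.2 = true ∧ ¬ (p.1 ∈ HA ∨ p.2 ∈ HB)).card = ε

theorem redStructure_of_card_le {n s ε : ℕ} {c : Fin n → Fin n → Bool} {HA HB : Finset (Fin n)}
    (hs : HA.card + HB.card = s) (he : s * n + ε ≤ redTotal c)
    (hrest : (Finset.univ.filter fun p : Fin n × Fin n =>
      c p.1 p.2 = true ∧ ¬ (p.1 ∈ HA ∨ p.2 ∈ HB)).card ≤ ε) : RedStructure c s ε := by
  set U : Finset (Fin n × Fin n) := Finset.univ.filter fun p => p.1 ∈ HA ∨ p.2 ∈ HB with hU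
  set T : Finset (Fin n × Fin n) :=
    Finset.univ.filter fun p => c p.1 p.2 = true ∧ (p.1 ∈ HA ∨ p.2 ∈ HB) with hT
  have hTU : T ⊆ U := by
    intro p hp
    simp only [hT, hU, Finset.mem_filter] at hp ⊢
    exact ⟨hp.1, hp.2.2⟩
  have hUcard : U.card + HA.card * HB.card = s * n := by
    have h1 : U = HA ×ˢ Finset.univ ∪ Finset.univ ×ˢ HB := by ext p; simp [hU]
    have h2 : HA ×ˢ HB = HA ×ˢ Finset.univ ∩ Finset.univ ×ˢ HB := by ext p; simp
    rw [← Finset.card_product, h1, h2, Finset.card_union_add_card_inter, Finset.card_product,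
      Finset.card_product, Finset.card_univ, Fintype.card_fin, ← hs]
    ring
  have htot : redTotal c = T.card + (Finset.univ.filter fun p : Fin n × Fin n =>
      c p.1 p.2 = true ∧ ¬ (p.1 ∈ HA ∨ p.2 ∈ HB)).card := by
    unfold redTotal
    rw [← Finset.card_filter_add_card_filter_not (fun p : Fin n × Fin n => p.1 ∈ HA ∨ p.2 ∈ HB),
      Finset.filter_filter, Finset.filter_filter]
  have hle := Finset.card_le_card hTU
  have hTeq : T = U := Finset.eq_of_subset_of_card_le hTU (by omega)
  refine ⟨HA, HB, hs, ?_, ?_, by omega⟩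
  · have : HA.card * HB.card = 0 := by omega
    simpa using this
  · intro a b hab
    have : (a, b) ∈ T := by rw [hTeq]; simpa [hU] using hab
    simp only [hT, Finset.mem_filter] at this
    exact this.2.1

theorem RedList.of_two_edges {n : ℕ} {c : Fin n → Fin n → Bool} {HA HB : Finset (Fin n)}
    (hAn : HA.card + 1 < n) (hBn : HB.card + 1 < n) {a b a' b' : Fin n} (h : c a b = true)
    (h' : c a' b' = true) (hne : (a, b) ≠ (a', b')) (ha : a ∉ HA) (hb : b ∉ HB) (ha' : a' ∉ HA)
    (hb' : b' ∉ HB) :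
    ∃ L, RedList c L ∧ L.length = 2 ∧ (∀ x ∈ HA, x ∉ L.map Prod.fst) ∧
      ∀ y ∈ HB, y ∉ L.map Prod.snd := by
  have avoid : ∀ {H : Finset (Fin n)} {x y : Fin n}, x ∉ H → y ∉ H →
      ∀ z ∈ H, z ∉ [x, y] := by
    intro H x y hx hy z hz hzm
    simp only [List.mem_cons, List.not_mem_nil, or_false] at hzm
    rcases hzm with rfl | rfl
    · exact hx hz
    · exact hy hz
  by_cases haa : a = a'
  · subst haa
    have hbb : b ≠ b' := fun e => hne (e ▸ rfl)
    obtain ⟨x, hx⟩ := exists_notMem (insert a HA)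
      ((Finset.card_insert_le _ _).trans_lt hAn)
    simp only [Finset.mem_insert, not_or] at hx
    refine ⟨[(a, b), (x, b')], ⟨?_, ?_, ?_⟩, rfl, avoid ha hx.2, avoid hb hb'⟩
    · simpa using Ne.symm hx.1
    · simpa using hbb
    · simp [listRed, headRed, h, h']
  · by_cases hbb : b = b'
    · subst hbb
      obtain ⟨y, hy⟩ := exists_notMem (insert b HB)
        ((Finset.card_insert_le _ _).trans_lt hBn)
      simp only [Finset.mem_insert, not_or] at hy
      refine ⟨[(a, y), (a', b)], ⟨?_, ?_, ?_⟩, rfl, avoid ha ha', avoid hy.2 hb⟩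
      · simpa using haa
      · simpa using hy.1
      · simp only [listRed, headRed, h, h', List.length_cons, List.length_nil]
        simp
    · refine ⟨[(a, b), (a', b')], ⟨?_, ?_, ?_⟩, rfl, avoid ha ha', avoid hb hb'⟩
      · simpa using haa
      · simpa using hbb
      · exact length_le_listRed c _ (by simp [h, h'])

theorem exists_high_degree {n m s : ℕ} {c : Fin n → Fin n → Bool} (hsm : s ≤ m)
    (hn : (m - 1) * (m - s) < n) (hmn : m ≤ n) (hno : ∀ L, RedList c L → L.length ≠ m)
    (he : s * n ≤ redTotal c) :
    s ≤ (Finset.univ.filter fun a => m ≤ (Finset.univ.filter fun b => c a b = true).card).card +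
      (Finset.univ.filter fun b => m ≤ (Finset.univ.filter fun a => c a b = true).card).card := by
  obtain ⟨CA, CB, hC, hcov⟩ := exists_cover hmn hno
  set HA := Finset.univ.filter fun a => m ≤ (Finset.univ.filter fun b => c a b = true).card with hHA
  set HB := Finset.univ.filter fun b => m ≤ (Finset.univ.filter fun a => c a b = true).card with hHB
  have hA : HA ⊆ CA := by
    intro a ha
    by_contra hnot
    have : (Finset.univ.filter fun b => c a b = true) ⊆ CB := by
      intro b hb
      exact (hcov a b (by simpa using hb)).resolve_left hnot
    have := Finset.card_le_card this
    simp only [hHA, Finset.mem_filter, Finset.mem_univ, true_and] at ha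
    omega
  have hB : HB ⊆ CB := by
    intro b hb
    by_contra hnot
    have : (Finset.univ.filter fun a => c a b = true) ⊆ CA := by
      intro a ha
      exact (hcov a b (by simpa using ha)).resolve_right hnot
    have := Finset.card_le_card this
    simp only [hHB, Finset.mem_filter, Finset.mem_univ, true_and] at hb
    omega
  have e0 := redTotal_le_of_cover hcov
  have e1 := sum_le_of_subset hA (fun a => (Finset.univ.filter fun b => c a b = true).card)
    (n := n) (r := m - 1) (fun a => (Finset.card_le_univ _).trans_eq (Fintype.card_fin n))
    (fun a ha => by
      simp only [hHA, Finset.mem_filter, Finset.mem_univ, true_and] at ha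
      omega)
  have e2 := sum_le_of_subset hB (fun b => (Finset.univ.filter fun a => c a b = true).card)
    (n := n) (r := m - 1) (fun a => (Finset.card_le_univ _).trans_eq (Fintype.card_fin n))
    (fun a ha => by
      simp only [hHB, Finset.mem_filter, Finset.mem_univ, true_and] at ha
      omega)
  have c1 := Finset.card_sdiff_add_card_eq_card hA
  have c2 := Finset.card_sdiff_add_card_eq_card hB
  by_contra! hlt
  obtain ⟨r, hr⟩ := Nat.exists_eq_add_of_lt hlt
  obtain ⟨w, hw⟩ := Nat.exists_eq_add_of_le hsm
  have hq : (CA \ HA).card + (CB \ HB).card ≤ w + r := by omega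
  have h3 : s * n ≤ ((CA \ HA).card + (CB \ HB).card) * (m - 1) + (HA.card + HB.card) * n := by
    linarith
  have h4 := Nat.mul_le_mul_right (m - 1) hq
  have h5 : r * (m - 1) ≤ r * n := Nat.mul_le_mul_left r (by omega)
  have h6 : m - s = w := by omega
  rw [h6] at hn
  have h7 : s * n = (HA.card + HB.card) * n + r * n + n := by rw [hr]; ring
  nlinarith

theorem redStructure_of_noRedList {n m s ε : ℕ} {c : Fin n → Fin n → Bool} (hε : ε ≤ 1)
    (hm : m = 2 * s + 1 + ε) (hn : (m - 1) * (m - s) < n) (hmn : m < n)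
    (hno : ∀ L, RedList c L → L.length ≠ m) (he : s * n + ε ≤ redTotal c) :
    RedStructure c s ε := by
  have hhigh := exists_high_degree (by omega) hn hmn.le hno (by omega)
  set HA' := Finset.univ.filter fun a => m ≤ (Finset.univ.filter fun b => c a b = true).card
    with hHA
  set HB' := Finset.univ.filter fun b => m ≤ (Finset.univ.filter fun a => c a b = true).card
    with hHB
  obtain ⟨HA, hAsub, hAc⟩ := Finset.exists_subset_card_eq (Nat.min_le_left HA'.card s)
  obtain ⟨HB, hBsub, hBc⟩ := Finset.exists_subset_card_eq
    (show s - min HA'.card s ≤ HB'.card by omega)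
  have hs : HA.card + HB.card = s := by omega
  refine redStructure_of_card_le hs he ?_
  by_contra! hlt
  have key : ∃ L, RedList c L ∧ L.length = ε + 1 ∧ (∀ x ∈ HA, x ∉ L.map Prod.fst) ∧
      ∀ y ∈ HB, y ∉ L.map Prod.snd := by
    interval_cases ε
    · obtain ⟨⟨a, b⟩, hp⟩ := Finset.card_pos.1 hlt
      simp only [Finset.mem_filter, Finset.mem_univ, true_and] at hp
      refine ⟨[(a, b)], ⟨by simp, by simp, by simp [listRed, headRed, hp.1]⟩, rfl, ?_, ?_⟩
      · intro x hx hxm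
        simp only [List.map_cons, List.map_nil, List.mem_singleton] at hxm
        exact hp.2.1 (hxm ▸ hx)
      · intro x hx hxm
        simp only [List.map_cons, List.map_nil, List.mem_singleton] at hxm
        exact hp.2.2 (hxm ▸ hx)
    · obtain ⟨⟨a, b⟩, hp, ⟨a', b'⟩, hp', hne⟩ := Finset.one_lt_card.1 hlt
      simp only [Finset.mem_filter, Finset.mem_univ, true_and] at hp hp'
      exact RedList.of_two_edges (by omega) (by omega) hp.1 hp'.1 hne hp.2.1 hp.2.2 hp'.2.1
        hp'.2.2
  obtain ⟨L, hL, hlen, hLA, hLB⟩ := key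
  obtain ⟨L', hL', hlen'⟩ := RedList.exists_extend hmn.le s HA HB L hs
    (fun a ha => by simpa [hHA] using hAsub ha) (fun b hb => by simpa [hHB] using hBsub hb)
    hL hLA hLB (by omega)
  exact hno L' hL' (by omega)

theorem redStructure_or_compl {n m s ε : ℕ} {c : Fin n → Fin n → Bool} (hε : ε ≤ 1)
    (hm : m = 2 * s + 1 + ε) (hn : (m - 1) * (m - s) < n) (hmn : m + 2 ≤ n)
    (h : NoBalanced m c) (h' : NoBalanced m (fun a b => c b a))
    (hr : s * n + ε ≤ redTotal c) (hb : s * n + ε ≤ redTotal (fun a b => !c a b)) :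
    RedStructure c s ε ∨ RedStructure (fun a b => !c a b) s ε := by
  have low : ∀ d : Fin n → Fin n → Bool, NoBalanced m d → NoBalanced m (fun a b => d b a) →
      s * n + ε ≤ redTotal d →
      (∃ f g : Fin (m + 1) → Fin n, Function.Injective f ∧ Function.Injective g ∧
        cycleRed d f g ≤ m) → RedStructure d s ε := by
    rintro d hd hd' hdr ⟨f, g, hf, hg, hle⟩
    refine redStructure_of_noRedList hε hm hn (by omega) (fun L hL hlen => ?_) hdr
    have h1 := hd.listRed_lt (by omega)
      (fun f' g' hf' hg' => hd.cycleRed_le_all hmn hd' hf hg hle hf' hg') L hL.nodup_fst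
      hL.nodup_snd hlen
    have h2 := hL.length_le
    omega
  have hinj := Fin.castLE_injective (show m + 1 ≤ n by omega)
  by_cases hle : cycleRed c (Fin.castLE (show m + 1 ≤ n by omega))
      (Fin.castLE (show m + 1 ≤ n by omega)) ≤ m
  · exact Or.inl (low c h h' hr ⟨_, _, hinj, hinj, hle⟩)
  · refine Or.inr (low _ h.compl h'.compl hb ⟨_, _, hinj, hinj, ?_⟩)
    have h1 := cycleRed_compl c (Fin.castLE (show m + 1 ≤ n by omega))
      (Fin.castLE (show m + 1 ≤ n by omega))
    have h2 := h.cycleRed_ne_succ h' hinj hinj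
    omega

theorem redTotal_compl {n : ℕ} (c : Fin n → Fin n → Bool) :
    redTotal (fun a b => !c a b) = blueTotal c := by
  simp [redTotal, blueTotal]

theorem redStructure_zero {n : ℕ} (c : Fin n → Fin n → Bool) :
    RedStructure c 0 (redTotal c) :=
  ⟨∅, ∅, by simp, by simp, by simp, by simp [redTotal]⟩

theorem monochromatic_of_two : ∀ p q r s : Bool,
    (∀ a b b' : Fin 2, b ≠ b' →
      (![![p, q], ![r, s]] a b).toNat + (![![p, q], ![r, s]] a b').toNat ≠ 1 ∧
      (![![p, q], ![r, s]] b a).toNat + (![![p, q], ![r, s]] b' a).toNat ≠ 1) →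
    redTotal ![![p, q], ![r, s]] = 0 ∨ blueTotal ![![p, q], ![r, s]] = 0 := by
  decide +kernel

theorem single_edge_of_three : ∀ p q r s t u v w x : Bool,
    (∀ a a' : Fin 3, a ≠ a' → ∀ b b' b'' : Fin 3, b ≠ b' → b ≠ b'' → b' ≠ b'' →
      (![![p, q, r], ![s, t, u], ![v, w, x]] a b).toNat +
        (![![p, q, r], ![s, t, u], ![v, w, x]] a b').toNat +
        ((![![p, q, r], ![s, t, u], ![v, w, x]] a' b').toNat +
        (![![p, q, r], ![s, t, u], ![v, w, x]] a' b'').toNat) ≠ 2 ∧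
      (![![p, q, r], ![s, t, u], ![v, w, x]] b a).toNat +
        (![![p, q, r], ![s, t, u], ![v, w, x]] b' a).toNat +
        ((![![p, q, r], ![s, t, u], ![v, w, x]] b' a').toNat +
        (![![p, q, r], ![s, t, u], ![v, w, x]] b'' a').toNat) ≠ 2) →
    redTotal ![![p, q, r], ![s, t, u], ![v, w, x]] ≤ 1 ∨
      blueTotal ![![p, q, r], ![s, t, u], ![v, w, x]] ≤ 1 := by
  decide +kernel

theorem NoBalanced.two {c : Fin 2 → Fin 2 → Bool} (h : NoBalanced 1 c) {a b b' : Fin 2}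
    (hb : b ≠ b') : (c a b).toNat + (c a b').toNat ≠ 1 := by
  have ha : Function.Injective ![a, a + 1] := by revert a; decide
  have hb : Function.Injective ![b, b'] := by revert b b'; decide
  have := h _ _ (injOn_ofNat ha 0) (injOn_ofNat hb 0)
  simpa [zigzag, Finset.sum_range_succ, Fin.ofNat] using this

theorem NoBalanced.three {c : Fin 3 → Fin 3 → Bool} (h : NoBalanced 2 c) {a a' b b' b'' : Fin 3}
    (haa : a ≠ a') (h1 : b ≠ b') (h2 : b ≠ b'') (h3 : b' ≠ b'') :
    (c a b).toNat + (c a b').toNat + ((c a' b').toNat + (c a' b'').toNat) ≠ 2 := by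
  obtain ⟨a'', ha⟩ : ∃ a'', Function.Injective ![a, a', a''] := by revert a a'; decide
  have hb : Function.Injective ![b, b', b''] := by revert b b' b''; decide
  have := h _ _ (injOn_ofNat ha 0) (injOn_ofNat hb 0)
  simpa [zigzag, Finset.sum_range_succ, Fin.ofNat] using this

theorem redStructure_or_compl_of_tight {n m : ℕ} {c : Fin n → Fin n → Bool} (hm : 1 ≤ m)
    (hm2 : m ≤ 2) (hn : n = m + 1) (h : NoBalanced m c) (h' : NoBalanced m (fun a b => c b a))
    (hr : m - 1 ≤ redTotal c) (hb : m - 1 ≤ redTotal (fun a b => !c a b)) :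
    RedStructure c 0 (m - 1) ∨ RedStructure (fun a b => !c a b) 0 (m - 1) := by
  have key : redTotal c ≤ m - 1 ∨ blueTotal c ≤ m - 1 := by
    subst hn
    interval_cases m
    · have hc : c = ![![c 0 0, c 0 1], ![c 1 0, c 1 1]] := by
        funext i j; fin_cases i <;> fin_cases j <;> rfl
      have := monochromatic_of_two (c 0 0) (c 0 1) (c 1 0) (c 1 1)
      rw [← hc] at this
      have := this fun a b b' hbb => ⟨h.two hbb, NoBalanced.two h' hbb⟩
      omega
    · have hc : c = ![![c 0 0, c 0 1, c 0 2], ![c 1 0, c 1 1, c 1 2], ![c 2 0, c 2 1, c 2 2]] := by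
        funext i j; fin_cases i <;> fin_cases j <;> rfl
      have := single_edge_of_three (c 0 0) (c 0 1) (c 0 2) (c 1 0) (c 1 1) (c 1 2) (c 2 0) (c 2 1)
        (c 2 2)
      rw [← hc] at this
      exact this fun a a' haa b b' b'' h1 h2 h3 =>
        ⟨h.three haa h1 h2 h3, NoBalanced.three h' haa h1 h2 h3⟩
  rcases key with hk | hk
  · left
    have := redStructure_zero c
    rwa [show redTotal c = m - 1 by omega] at this
  · right
    rw [← redTotal_compl] at hk
    have := redStructure_zero (fun a b => !c a b)
    rwa [show redTotal (fun a b => !c a b) = m - 1 by omega] at this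

theorem RedStructure.exists_complete {n s : ℕ} {c : Fin n → Fin n → Bool}
    (h : RedStructure c s 0) :
    ∃ S : Finset (Fin n), S.card = s ∧
      ((∀ v w, c v w = true ↔ v ∈ S) ∨ (∀ v w, c v w = true ↔ w ∈ S)) := by
  obtain ⟨HA, HB, hs, hor, hfull, hrest⟩ := h
  have hiff : ∀ v w, c v w = true ↔ v ∈ HA ∨ w ∈ HB := by
    intro v w
    refine ⟨fun hvw => ?_, hfull v w⟩
    by_contra hnot
    have : (v, w) ∈ (∅ : Finset (Fin n × Fin n)) := by
      rw [← Finset.card_eq_zero.1 hrest]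
      exact Finset.mem_filter.2 ⟨Finset.mem_univ _, hvw, hnot⟩
    simp at this
  rcases hor with rfl | rfl
  · exact ⟨HB, by simpa using hs, Or.inr fun v w => by simp [hiff]⟩
  · exact ⟨HA, by simpa using hs, Or.inl fun v w => by simp [hiff]⟩

theorem RedStructure.exists_pendant {n s : ℕ} {c : Fin n → Fin n → Bool}
    (h : RedStructure c s 1) :
    ∃ S : Finset (Fin n), S.card = s ∧ ∃ u w₀ : Fin n, u ∉ S ∧
      ((∀ v w, c v w = true ↔ (v ∈ S ∨ (v = u ∧ w = w₀))) ∨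
        (∀ v w, c v w = true ↔ (w ∈ S ∨ (w = u ∧ v = w₀)))) := by
  obtain ⟨HA, HB, hs, hor, hfull, hrest⟩ := h
  obtain ⟨⟨x, y⟩, hxy⟩ := Finset.card_eq_one.1 hrest
  have hmem : ∀ v w, (c v w = true ∧ ¬ (v ∈ HA ∨ w ∈ HB)) ↔ v = x ∧ w = y := by
    intro v w
    have := Finset.ext_iff.1 hxy (v, w)
    simpa only [Finset.mem_filter, Finset.mem_univ, true_and, Finset.mem_singleton,
      Prod.mk.injEq] using this
  have hiff : ∀ v w, c v w = true ↔ (v ∈ HA ∨ w ∈ HB) ∨ (v = x ∧ w = y) := by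
    intro v w
    have h1 := hmem v w
    have h2 := hfull v w
    tauto
  have hxy' := ((hmem x y).2 ⟨rfl, rfl⟩).2
  rw [not_or] at hxy'
  rcases hor with rfl | rfl
  · exact ⟨HB, by simpa using hs, y, x, hxy'.2, Or.inr fun v w => by simp [hiff, and_comm]⟩
  · exact ⟨HA, by simpa using hs, x, y, hxy'.1, Or.inl fun v w => by simp [hiff]⟩

/-- Characterization of the extremal colorings for paths.  Let `k ≥ 2` be even, `n ≥ 2`
with `n > ((k-2)/2)·(k/2 - ⌊(k-2)/4⌋)`, and `s = ⌊(k-2)/4⌋`.  Every 2-edge coloring of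
`K_{n,n}` with at least `p(n,k)` edges in each color class (`p(n,k) = s·n + 1` if
`k ≡ 0 (mod 4)`, `p(n,k) = s·n` if `k ≡ 2 (mod 4)`) either contains a balanced copy of
`P_k` (a path with `k` edges, exactly `k/2` of each color), or the graph formed by the
edges of one of the two colors is isomorphic to `K_{s,n}` (if `k ≡ 2 (mod 4)`), i.e. its
edges are exactly those between an `s`-set `S` of one part and the whole other part, or
isomorphic to `H_{s,n}`, the graph `K_{s,n}` with one extra pendant vertex attached to a
vertex of the part of size `n` (if `k ≡ 0 (mod 4)`). -/
theorem bbal_paths_characterization (k n : ℕ) (hk2 : 2 ≤ k) (hkeven : Even k)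
    (hn2 : 2 ≤ n) (hn : (k - 2) / 2 * (k / 2 - (k - 2) / 4) < n) :
    ∀ c : Fin n → Fin n → Bool,
      (if k % 4 = 0 then (k - 2) / 4 * n + 1 else (k - 2) / 4 * n) ≤ redTotal c →
      (if k % 4 = 0 then (k - 2) / 4 * n + 1 else (k - 2) / 4 * n) ≤ blueTotal c →
      (∃ v : Fin (k + 1) → Fin n ⊕ Fin n, IsPathCopy v ∧
        pathRedCount c v = k / 2 ∧ pathBlueCount c v = k / 2) ∨
      (∃ (b : Bool) (S : Finset (Fin n)), S.card = (k - 2) / 4 ∧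
        (if k % 4 = 0 then
          ∃ u w₀ : Fin n, u ∉ S ∧
            ((∀ v w, c v w = b ↔ (v ∈ S ∨ (v = u ∧ w = w₀))) ∨
             (∀ v w, c v w = b ↔ (w ∈ S ∨ (w = u ∧ v = w₀))))
        else
          ((∀ v w, c v w = b ↔ v ∈ S) ∨ (∀ v w, c v w = b ↔ w ∈ S)))) := by
  intro c hr hb
  obtain ⟨m, rfl⟩ := hkeven
  rw [or_iff_not_imp_left]
  intro hno
  rw [show (m + m) / 2 = m by omega] at hno
  obtain ⟨h, h'⟩ := noBalanced_of_not_exists c hno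
  obtain ⟨s, hs⟩ : ∃ s, s = (m + m - 2) / 4 := ⟨_, rfl⟩
  obtain ⟨ε, hε⟩ : ∃ ε, ε = if (m + m) % 4 = 0 then 1 else 0 := ⟨_, rfl⟩
  have hε1 : ε ≤ 1 := by split_ifs at hε <;> omega
  have hmε : m = 2 * s + 1 + ε := by split_ifs at hε <;> omega
  rw [← hs] at hr hb hn ⊢
  rw [show (m + m - 2) / 2 = m - 1 by omega, show (m + m) / 2 = m by omega] at hn
  have hp : (if (m + m) % 4 = 0 then s * n + 1 else s * n) = s * n + ε := by
    split_ifs at hε ⊢ <;> omega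
  rw [hp] at hr hb
  rw [← redTotal_compl] at hb
  have key : RedStructure c s ε ∨ RedStructure (fun a b => !c a b) s ε := by
    by_cases hmn : m + 2 ≤ n
    · exact redStructure_or_compl hε1 hmε hn hmn h h' hr hb
    · have hs0 : s = 0 := by
        by_contra hs0
        obtain ⟨r, rfl⟩ : ∃ r, s = r + 1 := ⟨s - 1, by omega⟩
        have h1 : (2 * r + 2) * (r + 2) ≤ (m - 1) * (m - (r + 1)) :=
          Nat.mul_le_mul (by omega) (by omega)
        have h2 : m + 1 ≤ (m - 1) * (m - (r + 1)) := by
          obtain rfl | rfl : ε = 0 ∨ ε = 1 := by omega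
          · nlinarith
          · have h3 : (2 * r + 3) * (r + 3) ≤ (m - 1) * (m - (r + 1)) :=
              Nat.mul_le_mul (by omega) (by omega)
            nlinarith
        omega
      subst hs0
      have hnm : n = m + 1 := by
        obtain rfl | rfl : m = 1 ∨ m = 2 := by omega
        · omega
        · omega
      have hεm : ε = m - 1 := by omega
      rw [hεm] at hr hb ⊢
      exact redStructure_or_compl_of_tight (by omega) (by omega) hnm h h'
        (by omega) (by omega)
  have hneg : ∀ x : Bool, x = false ↔ (!x) = true := by decide
  split_ifs at hε ⊢ with h4
  · subst hε
    rcases key with key | key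
    · exact ⟨true, key.exists_pendant⟩
    · refine ⟨false, ?_⟩
      simp only [hneg]
      exact key.exists_pendant
  · subst hε
    rcases key with key | key
    · exact ⟨true, key.exists_complete⟩
    · refine ⟨false, ?_⟩
      simp only [hneg]
      exact key.exists_complete
end
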